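/- arXiv:1706.05496 — 2 statements merged into one kernel-verified Lean document; each statement's English description precedes it below -/
import Mathlib

section
/- Let G₁ be a graph, u a vertex of G₁, and p ≥ 1. If G is obtained by substituting the complete graph K_p in G₁ at u, then xc(STAB(G)) ≤ xc(STAB(G₁)) + p; and if G is obtained by substituting the two-vertex edgeless graph (the complement of K₂) in G₁ at u, then xc(STAB(G)) ≤ xc(STAB(G₁)) + 3. -/
/-- A polytope is the convex hull of a finite set of points. -/
def IsPolytope {E : Type*} [AddCommGroup E] [Module ℝ E] (P : Set E) : Prop :=
  ∃ F : Set E, F.Finite ∧ P = convexHull ℝ F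

/-- An (exposed) face of a set `Q ⊆ ℝ^κ`. -/
def IsExposedFace {κ : Type*} [Fintype κ] (Q F : Set (κ → ℝ)) : Prop :=
  F ⊆ Q ∧ ∃ (c : κ → ℝ) (α : ℝ), (∀ y ∈ Q, ∑ i, c i * y i ≤ α) ∧
    F = {y ∈ Q | ∑ i, c i * y i = α}

/-- A facet of `Q`: a maximal proper nonempty face of `Q`. -/
def IsFacet {κ : Type*} [Fintype κ] (Q F : Set (κ → ℝ)) : Prop :=
  IsExposedFace Q F ∧ F.Nonempty ∧ F ≠ Q ∧
    ∀ F' : Set (κ → ℝ), IsExposedFace Q F' → F'.Nonempty → F' ≠ Q → F ⊆ F' → F' = F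

/-- The size of a polytope: its number of facets. -/
noncomputable def polySize {κ : Type*} [Fintype κ] (Q : Set (κ → ℝ)) : ℕ :=
  {F : Set (κ → ℝ) | IsFacet Q F}.ncard

/-- `Q` is an extension of `P` if `Q` is a polytope and some linear map sends `Q` onto `P`. -/
def IsExtension {ι κ : Type*} [Fintype ι] [Fintype κ]
    (P : Set (ι → ℝ)) (Q : Set (κ → ℝ)) : Prop :=
  IsPolytope Q ∧ ∃ π : (κ → ℝ) →ₗ[ℝ] (ι → ℝ), π '' Q = P

/-- The extension complexity of `P`: the minimum number of facets of an extension of `P`. -/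
noncomputable def xc {ι : Type*} [Fintype ι] (P : Set (ι → ℝ)) : ℕ :=
  sInf {r : ℕ | ∃ (k : ℕ) (Q : Set (Fin k → ℝ)), IsExtension P Q ∧ polySize Q = r}

/-- The stable set polytope of a graph: the convex hull of the characteristic vectors of
its independent (stable) sets. -/
def stab {V : Type*} [Fintype V] (G : SimpleGraph V) : Set (V → ℝ) :=
  convexHull ℝ {x : V → ℝ |
    ∃ S : Set V, (∀ u ∈ S, ∀ v ∈ S, ¬ G.Adj u v) ∧ x = S.indicator 1}

/-- The graph obtained by substituting `G₂` in `G₁` at the vertex `u`: its vertices are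
`(V₁ \\ {u}) ⊕ V₂`, with the edges of `G₁` among `V₁ \\ {u}`, the edges of `G₂`, and all
pairs `{v, w}` with `v ∈ V₂`, `w ∈ V₁ \\ {u}` such that `{u, w}` is an edge of `G₁`. -/
def substGraph {V₁ V₂ : Type*} (G₁ : SimpleGraph V₁) (u : V₁) (G₂ : SimpleGraph V₂) :
    SimpleGraph ({v : V₁ // v ≠ u} ⊕ V₂) :=
  SimpleGraph.fromRel fun a b =>
    match a, b with
    | Sum.inl v, Sum.inl w => G₁.Adj v.1 w.1
    | Sum.inl v, Sum.inr _ => G₁.Adj u v.1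
    | Sum.inr _, Sum.inl w => G₁.Adj u w.1
    | Sum.inr x, Sum.inr y => G₂.Adj x y

open Set in
lemma aux_face_eq {κ : Type*} [Fintype κ] (F : Finset (κ → ℝ)) (G : Set (κ → ℝ))
    (h : IsExposedFace (convexHull ℝ (F : Set (κ → ℝ))) G) :
    G = convexHull ℝ ((F : Set (κ → ℝ)) ∩ G) := by
  classical
  obtain ⟨hsub, c, α, hv, rfl⟩ := h
  apply Set.Subset.antisymm
  · rintro x ⟨hx, hxα⟩
    rw [Finset.mem_convexHull'] at hx
    obtain ⟨w, hw0, hw1, hwx⟩ := hx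
    have hcx : ∑ f ∈ F, w f * (α - ∑ i, c i * f i) = 0 := by
      have e1 : ∑ i, c i * x i = ∑ f ∈ F, w f * ∑ i, c i * f i := by
        rw [← hwx]
        simp only [Finset.sum_apply, Pi.smul_apply, smul_eq_mul, Finset.mul_sum]
        rw [Finset.sum_comm]
        refine Finset.sum_congr rfl fun _ _ => Finset.sum_congr rfl fun _ _ => by ring
      simp only [mul_sub, Finset.sum_sub_distrib]
      rw [← Finset.sum_mul, hw1, ← e1, hxα]; ring
    have hz := (Finset.sum_eq_zero_iff_of_nonneg (fun f hf =>
      mul_nonneg (hw0 f hf) (sub_nonneg.2 (hv f (subset_convexHull ℝ _ hf))))).1 hcx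
    have hsum : x = ∑ f ∈ F.filter (fun f => w f ≠ 0), w f • f := by
      rw [← hwx, Finset.sum_filter]
      refine Finset.sum_congr rfl fun f _ => ?_
      by_cases h0 : w f = 0 <;> simp [h0]
    rw [hsum]
    refine (convex_convexHull ℝ _).sum_mem (fun f hf => hw0 f (Finset.mem_filter.1 hf).1) ?_ ?_
    · rw [Finset.sum_filter_ne_zero]; exact hw1
    · intro f hf
      obtain ⟨hf, hne⟩ := Finset.mem_filter.1 hf
      apply subset_convexHull
      refine ⟨hf, subset_convexHull ℝ _ hf, ?_⟩
      rcases mul_eq_zero.1 (hz f hf) with h | h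
      · exact absurd h hne
      · linarith
  · apply convexHull_min Set.inter_subset_right
    have : Convex ℝ {y : κ → ℝ | ∑ i, c i * y i = α} := by
      intro x hx y hy a b _ _ hab
      simp only [Set.mem_ofPred_eq, Pi.add_apply, Pi.smul_apply, smul_eq_mul] at *
      have : ∑ i, c i * (a * x i + b * y i) = a * ∑ i, c i * x i + b * ∑ i, c i * y i := by
        rw [Finset.mul_sum, Finset.mul_sum, ← Finset.sum_add_distrib]
        exact Finset.sum_congr rfl fun _ _ => by ring
      rw [this, hx, hy, ← add_mul, hab, one_mul]
    exact (convex_convexHull ℝ _).inter this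

lemma aux_facets_finite {κ : Type*} [Fintype κ] (Q : Set (κ → ℝ)) (hQ : IsPolytope Q) :
    {F : Set (κ → ℝ) | IsFacet Q F}.Finite := by
  obtain ⟨F, hF, rfl⟩ := hQ
  refine ((hF.powerset).image (fun A => convexHull ℝ A)).subset ?_
  intro G hG
  refine ⟨F ∩ G, Set.inter_subset_left, ?_⟩
  have := aux_face_eq hF.toFinset G (by simpa using hG.1)
  simpa using this.symm

/-- The lifted polytope. -/
def liftSet {k : ℕ} (Q : Set (Fin k → ℝ)) (m : Fin k → ℝ) (p : ℕ) : Set (Fin (k + p) → ℝ) :=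
  {q | (fun j => q (Fin.castAdd p j)) ∈ Q ∧ (∀ i, 0 ≤ q (Fin.natAdd k i)) ∧
    ∑ i, q (Fin.natAdd k i) = ∑ j, m j * q (Fin.castAdd p j)}

/-- The lifting maps. -/
def liftMap {k : ℕ} (m : Fin k → ℝ) {p : ℕ} (i : Fin p) : (Fin k → ℝ) →ₗ[ℝ] (Fin (k + p) → ℝ) where
  toFun y := Fin.append y (Pi.single i (∑ j, m j * y j))
  map_add' x y := by
    ext t
    refine Fin.addCases (fun j => ?_) (fun j => ?_) t
    · simp
    · by_cases h : j = i
      · subst h; simp [mul_add, Finset.sum_add_distrib]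
      · simp [h]
  map_smul' a y := by
    ext t
    refine Fin.addCases (fun j => ?_) (fun j => ?_) t
    · simp
    · by_cases h : j = i
      · subst h; simp [Finset.mul_sum]; exact Finset.sum_congr rfl fun _ _ => by ring
      · simp [h]

@[simp] lemma liftMap_castAdd {k p : ℕ} (m : Fin k → ℝ) (i : Fin p) (y : Fin k → ℝ) (j : Fin k) :
    liftMap m i y (Fin.castAdd p j) = y j := by simp [liftMap]

@[simp] lemma liftMap_natAdd {k p : ℕ} (m : Fin k → ℝ) (i : Fin p) (y : Fin k → ℝ) (j : Fin p) :
    liftMap m i y (Fin.natAdd k j) = (Pi.single i (∑ j, m j * y j) : Fin p → ℝ) j := by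
  simp [liftMap]

lemma liftMap_mem {k p : ℕ} (Q : Set (Fin k → ℝ)) (m : Fin k → ℝ)
    (hm : ∀ y ∈ Q, 0 ≤ ∑ j, m j * y j) (i : Fin p) (y : Fin k → ℝ) (hy : y ∈ Q) :
    liftMap m i y ∈ liftSet Q m p := by
  refine ⟨by simpa using hy, fun j => ?_, by simp⟩
  rw [liftMap_natAdd]
  by_cases h : j = i
  · subst h; simpa using hm y hy
  · simp [h]

lemma liftSet_eq {k p : ℕ} (hp : 1 ≤ p) (F : Set (Fin k → ℝ)) (m : Fin k → ℝ)
    (hm : ∀ y ∈ convexHull ℝ F, 0 ≤ ∑ j, m j * y j) :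
    liftSet (convexHull ℝ F) m p = convexHull ℝ (⋃ i : Fin p, liftMap m i '' F) := by
  apply Set.Subset.antisymm
  · rintro q ⟨hq, hq0, hqs⟩
    set y : Fin k → ℝ := fun j => q (Fin.castAdd p j) with hy
    have hmem : ∀ i : Fin p, liftMap m i y ∈ convexHull ℝ (⋃ i : Fin p, liftMap m i '' F) := by
      intro i
      have : liftMap m i y ∈ liftMap m i '' convexHull ℝ F := ⟨y, hq, rfl⟩
      rw [LinearMap.image_convexHull] at this
      exact convexHull_mono (Set.subset_iUnion (fun i : Fin p => liftMap m i '' F) i) this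
    set t := ∑ j, m j * y j with ht
    have ht0 : 0 ≤ t := hm y hq
    rcases ht0.eq_or_lt with h0 | h0
    · have hz : ∀ i, q (Fin.natAdd k i) = 0 := by
        have h1 : ∑ i, q (Fin.natAdd k i) = 0 := by rw [hqs, h0]
        have := (Finset.sum_eq_zero_iff_of_nonneg (fun i _ => hq0 i)).1 h1
        exact fun i => this i (Finset.mem_univ _)
      have : q = liftMap m (⟨0, hp⟩ : Fin p) y := by
        ext s
        refine Fin.addCases (fun j => ?_) (fun j => ?_) s
        · simp [hy]
        · rw [hz, liftMap_natAdd, ← ht, ← h0]; simp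
      rw [this]; exact hmem _
    · have : q = ∑ i : Fin p, (q (Fin.natAdd k i) / t) • liftMap m i y := by
        have h1 : ∑ i, q (Fin.natAdd k i) / t = 1 := by
          rw [← Finset.sum_div, hqs]; exact div_self h0.ne'
        ext s
        refine Fin.addCases (fun j => ?_) (fun j => ?_) s
        · simp only [Finset.sum_apply, Pi.smul_apply, liftMap_castAdd, smul_eq_mul]
          rw [← Finset.sum_mul, h1, one_mul]
        · simp only [Finset.sum_apply, Pi.smul_apply, liftMap_natAdd, smul_eq_mul, ← ht]
          rw [Finset.sum_eq_single j]
          · simp [h0.ne']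
          · intro b _ hb; simp [hb.symm]
          · simp
      rw [this]
      refine (convex_convexHull ℝ _).sum_mem (fun i _ => div_nonneg (hq0 i) ht0) ?_ fun i _ => hmem i
      rw [← Finset.sum_div, hqs]; exact div_self h0.ne'
  · apply convexHull_min
    · rintro _ ⟨_, ⟨i, rfl⟩, y, hy, rfl⟩
      exact liftMap_mem _ m hm i y (subset_convexHull ℝ _ hy)
    · rintro x ⟨hx, hx0, hxs⟩ y ⟨hy, hy0, hys⟩ a b ha hb hab
      refine ⟨convex_convexHull ℝ F hx hy ha hb hab, fun i => ?_, ?_⟩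
      · exact add_nonneg (mul_nonneg ha (hx0 i)) (mul_nonneg hb (hy0 i))
      · simp only [Pi.add_apply, Pi.smul_apply, smul_eq_mul, Finset.sum_add_distrib, mul_add,
          ← Finset.mul_sum, hxs, hys]
        simp only [Finset.mul_sum]
        congr 1 <;> exact Finset.sum_congr rfl fun _ _ => by ring

lemma aux_pre_face {k p : ℕ} (Q : Set (Fin k → ℝ)) (m : Fin k → ℝ) (F : Set (Fin k → ℝ))
    (hF : IsExposedFace Q F) :
    IsExposedFace (liftSet Q m p) {q ∈ liftSet Q m p | (fun j => q (Fin.castAdd p j)) ∈ F} := by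
  obtain ⟨_, c, α, hv, rfl⟩ := hF
  refine ⟨Set.sep_subset _ _, Fin.append c 0, α, ?_, ?_⟩
  · intro q hq
    simpa [Fin.sum_univ_add] using hv _ hq.1
  · ext q
    simp only [Set.mem_ofPred_eq, Fin.sum_univ_add, Fin.append_left, Fin.append_right, Pi.zero_apply,
      zero_mul, Finset.sum_const_zero, add_zero]
    exact ⟨fun h => ⟨h.1, h.2.2⟩, fun h => ⟨h.1, h.1.1, h.2⟩⟩

lemma liftSet_facet {k p : ℕ} (hp : 1 ≤ p) (Q : Set (Fin k → ℝ)) (m : Fin k → ℝ)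
    (hm : ∀ y ∈ Q, 0 ≤ ∑ j, m j * y j) (G : Set (Fin (k + p) → ℝ))
    (hG : IsFacet (liftSet Q m p) G) :
    (∃ F, IsFacet Q F ∧ {q ∈ liftSet Q m p | (fun j => q (Fin.castAdd p j)) ∈ F} = G) ∨
    (∃ i : Fin p, {q ∈ liftSet Q m p | q (Fin.natAdd k i) = 0} = G) := by
  obtain ⟨⟨hsub, c, α, hv, hGe⟩, hne, hproper, hmax⟩ := hG
  have : Nonempty (Fin p) := ⟨⟨0, hp⟩⟩
  obtain ⟨i0, hi0⟩ := Finite.exists_max (fun i : Fin p => c (Fin.natAdd k i))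
  set D := c (Fin.natAdd k i0) with hD
  -- bound
  have hdec : ∀ q ∈ liftSet Q m p, ∑ t, c t * q t =
      ∑ j, (c (Fin.castAdd p j) + D * m j) * q (Fin.castAdd p j)
        - ∑ i, (D - c (Fin.natAdd k i)) * q (Fin.natAdd k i) := by
    rintro q ⟨_, _, hqs⟩
    rw [Fin.sum_univ_add]
    simp only [add_mul, sub_mul, Finset.sum_add_distrib, Finset.sum_sub_distrib, mul_assoc,
      ← Finset.mul_sum, hqs]
    ring
  have hvQ : ∀ y ∈ Q, ∑ j, (c (Fin.castAdd p j) + D * m j) * y j ≤ α := by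
    intro y hy
    have hl := liftMap_mem Q m hm i0 y hy
    have h1 := hv _ hl
    rw [hdec _ hl] at h1
    have h2 : ∑ i, (D - c (Fin.natAdd k i)) * liftMap m i0 y (Fin.natAdd k i) = 0 := by
      apply Finset.sum_eq_zero
      intro i _
      rw [liftMap_natAdd]
      by_cases h : i = i0
      · subst h; simp [hD]
      · simp [h]
    rw [h2] at h1
    simpa using h1
  have hnn : ∀ q ∈ liftSet Q m p, ∀ i, 0 ≤ (D - c (Fin.natAdd k i)) * q (Fin.natAdd k i) :=
    fun q hq i => mul_nonneg (sub_nonneg.2 (hi0 i)) (hq.2.1 i)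
  by_cases hcase : ∃ i, c (Fin.natAdd k i) < D ∧ ∃ q ∈ liftSet Q m p, q (Fin.natAdd k i) ≠ 0
  · right
    obtain ⟨i, hi, q0, hq0, hq0i⟩ := hcase
    refine ⟨i, hmax _ ⟨Set.sep_subset _ _, Fin.append 0 (Pi.single i (-1)), 0, ?_, ?_⟩ ?_ ?_ ?_⟩
    · intro q hq
      simp [Fin.sum_univ_add, Pi.single_apply, hq.2.1 i]
    · ext q
      simp [Fin.sum_univ_add, Pi.single_apply]
    rotate_left
    · intro h
      rw [← h] at hq0
      exact hq0i hq0.2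
    rotate_left
    all_goals
      have hsubi : G ⊆ {q ∈ liftSet Q m p | q (Fin.natAdd k i) = 0} := by
        intro q hq
        rw [hGe] at hq
        refine ⟨hq.1, ?_⟩
        have h1 := hdec q hq.1
        have h2 := hvQ _ hq.1.1
        have h4 : ∑ i, (D - c (Fin.natAdd k i)) * q (Fin.natAdd k i) = 0 := by
          have h3 := Finset.sum_nonneg (fun i (_ : i ∈ Finset.univ) => hnn q hq.1 i)
          have := hq.2
          linarith
        have h5 := (Finset.sum_eq_zero_iff_of_nonneg (fun i _ => hnn q hq.1 i)).1 h4 i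
          (Finset.mem_univ _)
        rcases mul_eq_zero.1 h5 with h | h
        · linarith
        · exact h
    · exact hne.mono hsubi
    · exact hsubi
  · left
    push Not at hcase
    have hdec' : ∀ q ∈ liftSet Q m p, ∑ t, c t * q t =
        ∑ j, (c (Fin.castAdd p j) + D * m j) * q (Fin.castAdd p j) := by
      intro q hq
      rw [hdec q hq, sub_eq_self]
      apply Finset.sum_eq_zero
      intro i _
      rcases (hi0 i).eq_or_lt with h | h
      · rw [h]; simp [hD]
      · rw [hcase i h q hq, mul_zero]
    set F : Set (Fin k → ℝ) := {y ∈ Q | ∑ j, (c (Fin.castAdd p j) + D * m j) * y j = α} with hF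
    have hFG : {q ∈ liftSet Q m p | (fun j => q (Fin.castAdd p j)) ∈ F} = G := by
      rw [hGe]
      ext q
      constructor
      · rintro ⟨hq, _, h⟩
        exact ⟨hq, by rw [hdec' q hq]; exact h⟩
      · rintro ⟨hq, h⟩
        exact ⟨hq, hq.1, by rw [hdec' q hq] at h; exact h⟩
    have hproj : ∀ y, (fun j => liftMap m i0 y (Fin.castAdd p j)) = y := by
      intro y; ext j; simp
    refine ⟨F, ⟨⟨Set.sep_subset _ _, _, α, hvQ, rfl⟩, ?_, ?_, ?_⟩, hFG⟩
    · obtain ⟨q, hq⟩ := hne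
      rw [← hFG] at hq
      exact ⟨_, hq.2⟩
    · intro h
      apply hproper
      rw [← hFG, h]
      ext q
      exact ⟨fun h => h.1, fun h => ⟨h, h.1⟩⟩
    · intro F2 hF2 hF2n hF2p hFF2
      have key := hmax _ (aux_pre_face (p := p) Q m F2 hF2) ?_ ?_ ?_
      · apply Set.Subset.antisymm _ hFF2
        intro y hy
        have : liftMap m i0 y ∈ G := by
          rw [← key]
          exact ⟨liftMap_mem Q m hm i0 y (hF2.1 hy), by rw [hproj]; exact hy⟩
        rw [← hFG] at this
        have := this.2
        rwa [hproj] at this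
      · obtain ⟨y, hy⟩ := hF2n
        exact ⟨liftMap m i0 y, liftMap_mem Q m hm i0 y (hF2.1 hy), by rw [hproj]; exact hy⟩
      · intro h
        apply hF2p
        apply Set.Subset.antisymm hF2.1
        intro y hy
        have := liftMap_mem Q m hm i0 y hy
        rw [← h] at this
        have := this.2
        rwa [hproj] at this
      · rw [← hFG]
        rintro q ⟨hq, h⟩
        exact ⟨hq, hFF2 h⟩

lemma liftSet_size {k p : ℕ} (hp : 1 ≤ p) (Q : Set (Fin k → ℝ)) (hQ : IsPolytope Q)
    (m : Fin k → ℝ) (hm : ∀ y ∈ Q, 0 ≤ ∑ j, m j * y j) :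
    polySize (liftSet Q m p) ≤ polySize Q + p := by
  have hfin := aux_facets_finite Q hQ
  set A := (fun F => {q ∈ liftSet Q m p | (fun j => q (Fin.castAdd p j)) ∈ F}) ''
    {F : Set (Fin k → ℝ) | IsFacet Q F} with hA
  set B := (fun i : Fin p => {q ∈ liftSet Q m p | q (Fin.natAdd k i) = 0}) '' Set.univ with hB
  have hAf : A.Finite := hfin.image _
  have hBf : B.Finite := Set.finite_univ.image _
  have hsub : {G | IsFacet (liftSet Q m p) G} ⊆ A ∪ B := by
    intro G hG
    rcases liftSet_facet hp Q m hm G hG with ⟨F, h1, h2⟩ | ⟨i, h⟩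
    · exact Or.inl ⟨F, h1, h2⟩
    · exact Or.inr ⟨i, trivial, h⟩
  have hB2 : B.ncard ≤ p := by
    have := Set.ncard_image_le (f := fun i : Fin p => {q ∈ liftSet Q m p | q (Fin.natAdd k i) = 0})
      (Set.finite_univ)
    rw [hB]
    refine this.trans ?_
    simp [Set.ncard_univ]
  calc polySize (liftSet Q m p) ≤ (A ∪ B).ncard := Set.ncard_le_ncard hsub (hAf.union hBf)
    _ ≤ A.ncard + B.ncard := Set.ncard_union_le _ _
    _ ≤ polySize Q + p := add_le_add (Set.ncard_image_le hfin) hB2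

lemma stab_isPolytope {V : Type*} [Fintype V] (G : SimpleGraph V) : IsPolytope (stab G) := by
  refine ⟨_, ?_, rfl⟩
  refine (Set.finite_range (fun S : Set V => (S.indicator 1 : V → ℝ))).subset ?_
  rintro x ⟨S, _, rfl⟩
  exact ⟨S, rfl⟩

lemma xc_attained {V : Type*} [Fintype V] (G : SimpleGraph V) :
    ∃ (k : ℕ) (Q : Set (Fin k → ℝ)), IsExtension (stab G) Q ∧ polySize Q = xc (stab G) := by
  have : {r : ℕ | ∃ (k : ℕ) (Q : Set (Fin k → ℝ)), IsExtension (stab G) Q ∧ polySize Q = r}.Nonempty := by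
    let e := LinearEquiv.funCongrLeft ℝ ℝ (Fintype.equivFin V)
    refine ⟨_, Fintype.card V, e.symm.toLinearMap '' stab G, ⟨?_, e.toLinearMap, ?_⟩, rfl⟩
    · obtain ⟨F, hF, h⟩ := stab_isPolytope G
      exact ⟨e.symm.toLinearMap '' F, hF.image _, by rw [h, LinearMap.image_convexHull]⟩
    · rw [← Set.image_comp]
      have : (e.toLinearMap : _ → _) ∘ (e.symm.toLinearMap : _ → _) = id := by
        ext x; simp
      rw [this, Set.image_id]
  exact Nat.sInf_mem this

/-- Coordinates of a substituted point. -/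
noncomputable def substMap {V₁ V₂ : Type*} (u : V₁) (a : Set V₂) :
    (V₁ → ℝ) →ₗ[ℝ] ({v : V₁ // v ≠ u} ⊕ V₂ → ℝ) where
  toFun x := Sum.elim (fun v => x v.1) (fun w => x u * a.indicator 1 w)
  map_add' x y := by ext (v | v) <;> simp [add_mul]
  map_smul' r y := by ext (v | v) <;> simp [mul_assoc]

lemma stab_subst {V₁ V₂ : Type*} [Fintype V₁] [Fintype V₂] [DecidableEq V₁]
    (G₁ : SimpleGraph V₁) (u : V₁) (G₂ : SimpleGraph V₂) (p : ℕ) (hp : 1 ≤ p)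
    (a : Fin p → Set V₂) (ha : ∀ i, ∀ v ∈ a i, ∀ w ∈ a i, ¬ G₂.Adj v w)
    (ha' : ∀ S : Set V₂, S.Nonempty → (∀ v ∈ S, ∀ w ∈ S, ¬ G₂.Adj v w) → ∃ i, a i = S) :
    {x | ∃ S : Set ({v : V₁ // v ≠ u} ⊕ V₂),
      (∀ v ∈ S, ∀ w ∈ S, ¬ (substGraph G₁ u G₂).Adj v w) ∧ x = S.indicator 1} =
    ⋃ i, substMap u (a i) '' {x : V₁ → ℝ |
      ∃ S : Set V₁, (∀ u ∈ S, ∀ v ∈ S, ¬ G₁.Adj u v) ∧ x = S.indicator 1} := by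
  classical
  have hll : ∀ v w, (substGraph G₁ u G₂).Adj (Sum.inl v) (Sum.inl w) ↔ G₁.Adj v.1 w.1 := by
    intro v w
    simp only [substGraph, SimpleGraph.fromRel_adj, ne_eq, Sum.inl.injEq]
    constructor
    · rintro ⟨_, h | h⟩
      · exact h
      · exact h.symm
    · intro h
      exact ⟨fun e => h.ne (by rw [e]), Or.inl h⟩
  have hlr : ∀ v w, (substGraph G₁ u G₂).Adj (Sum.inl v) (Sum.inr w) ↔ G₁.Adj u v.1 := by
    intro v w
    simp [substGraph, SimpleGraph.fromRel_adj]
  have hrr : ∀ v w, (substGraph G₁ u G₂).Adj (Sum.inr v) (Sum.inr w) ↔ G₂.Adj v w := by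
    intro v w
    simp only [substGraph, SimpleGraph.fromRel_adj, ne_eq, Sum.inr.injEq]
    constructor
    · rintro ⟨_, h | h⟩
      · exact h
      · exact h.symm
    · intro h
      exact ⟨h.ne, Or.inl h⟩
  ext x
  simp only [Set.mem_iUnion, Set.mem_image, Set.mem_ofPred_eq]
  constructor
  · rintro ⟨S, hS, rfl⟩
    by_cases hne : (Sum.inr ⁻¹' S : Set V₂).Nonempty
    · obtain ⟨i, hi⟩ := ha' (Sum.inr ⁻¹' S) hne
        (fun v hv w hw h => hS _ hv _ hw ((hrr v w).2 h))
      obtain ⟨w0, hw0⟩ := hne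
      refine ⟨i, _, ⟨{v | v = u ∨ ∃ h : v ≠ u, Sum.inl ⟨v, h⟩ ∈ S}, ?_, rfl⟩, ?_⟩
      · rintro v (rfl | ⟨hv, hvS⟩) w (rfl | ⟨hw, hwS⟩) h
        · exact h.ne rfl
        · exact hS _ hwS _ hw0 ((hlr _ _).2 h)
        · exact hS _ hvS _ hw0 ((hlr _ _).2 h.symm)
        · exact hS _ hvS _ hwS ((hll _ _).2 h)
      · ext (v | v)
        · simp [substMap, Set.indicator_apply, v.2]
        · simp [substMap, Set.indicator_apply, hi]
    · refine ⟨⟨0, hp⟩, _, ⟨{v | ∃ h : v ≠ u, Sum.inl ⟨v, h⟩ ∈ S}, ?_, rfl⟩, ?_⟩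
      · rintro v ⟨hv, hvS⟩ w ⟨hw, hwS⟩ h
        exact hS _ hvS _ hwS ((hll _ _).2 h)
      · have hno : ∀ w, Sum.inr w ∉ S := fun w hw => hne ⟨w, hw⟩
        ext (v | v)
        · simp [substMap, Set.indicator_apply, v.2]
        · simp [substMap, Set.indicator_apply, hno]
  · rintro ⟨i, _, ⟨S, hS, rfl⟩, rfl⟩
    refine ⟨{t | Sum.elim (fun v => v.1 ∈ S) (fun w => u ∈ S ∧ w ∈ a i) t}, ?_, ?_⟩
    · rintro (v | v) hv (w | w) hw h
      · exact hS _ hv _ hw ((hll _ _).1 h)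
      · exact hS _ hw.1 _ hv ((hlr _ _).1 h)
      · exact hS _ hv.1 _ hw ((hlr _ _).1 h.symm)
      · exact ha i _ hv.2 _ hw.2 ((hrr _ _).1 h)
    · ext (v | v)
      · by_cases h1 : v.1 ∈ S <;> simp [substMap, Set.indicator_apply, h1]
      · by_cases h1 : u ∈ S <;> by_cases h2 : v ∈ a i <;>
          simp [substMap, Set.indicator_apply, h1, h2]

lemma convexHull_iUnion_congr {E ι : Type*} [AddCommGroup E] [Module ℝ E] (s : ι → Set E) :
    convexHull ℝ (⋃ i, convexHull ℝ (s i)) = convexHull ℝ (⋃ i, s i) := by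
  apply Set.Subset.antisymm
  · refine convexHull_min (Set.iUnion_subset fun i => convexHull_mono (Set.subset_iUnion s i))
      (convex_convexHull ℝ _)
  · exact convexHull_mono (Set.iUnion_mono fun i => subset_convexHull ℝ _)

lemma xc_subst {V₁ V₂ : Type*} [Fintype V₁] [Fintype V₂] [DecidableEq V₁]
    (G₁ : SimpleGraph V₁) (u : V₁) (G₂ : SimpleGraph V₂) (p : ℕ) (hp : 1 ≤ p)
    (a : Fin p → Set V₂) (ha : ∀ i, ∀ v ∈ a i, ∀ w ∈ a i, ¬ G₂.Adj v w)
    (ha' : ∀ S : Set V₂, S.Nonempty → (∀ v ∈ S, ∀ w ∈ S, ¬ G₂.Adj v w) → ∃ i, a i = S) :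
    xc (stab (substGraph G₁ u G₂)) ≤ xc (stab G₁) + p := by
  classical
  obtain ⟨k, Q, ⟨hQ, π, hπ⟩, hsize⟩ := xc_attained G₁
  set m : Fin k → ℝ := fun j => π (Pi.single j 1) u with hmdef
  have hmπ : ∀ y, ∑ j, m j * y j = π y u := by
    intro y
    conv_rhs => rw [← Finset.univ_sum_single y]
    rw [map_sum, Finset.sum_apply]
    refine Finset.sum_congr rfl fun j _ => ?_
    have : (Pi.single j (y j) : Fin k → ℝ) = y j • Pi.single j 1 := by
      rw [← Pi.single_smul]; simp
    rw [this, map_smul]; simp [hmdef, mul_comm]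
  have hstabnn : ∀ x ∈ stab G₁, 0 ≤ x u := by
    intro x hx
    have hc : Convex ℝ {x : V₁ → ℝ | 0 ≤ x u} := by
      intro x hx y hy a b ha hb _
      exact add_nonneg (mul_nonneg ha hx) (mul_nonneg hb hy)
    refine (convexHull_min ?_ hc : stab G₁ ⊆ _) hx
    rintro _ ⟨S, _, rfl⟩
    by_cases h : u ∈ S <;> simp [h]
  have hm : ∀ y ∈ Q, 0 ≤ ∑ j, m j * y j := by
    intro y hy
    rw [hmπ]; exact hstabnn _ (hπ ▸ ⟨y, hy, rfl⟩)
  rw [← hsize]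
  refine le_trans ?_ (liftSet_size hp Q hQ m hm)
  apply Nat.sInf_le
  refine ⟨k + p, liftSet Q m p, ⟨?_, ?_⟩, rfl⟩
  · obtain ⟨F, hF, rfl⟩ := hQ
    exact ⟨_, Set.finite_iUnion fun i : Fin p => hF.image (liftMap m i), liftSet_eq hp F m hm⟩
  · let M : (Fin (k + p) → ℝ) →ₗ[ℝ] ({v : V₁ // v ≠ u} ⊕ V₂ → ℝ) :=
      { toFun := fun q => Sum.elim (fun v => π (fun j => q (Fin.castAdd p j)) v.1)
          (fun w => ∑ i, q (Fin.natAdd k i) * (a i).indicator 1 w)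
        map_add' := fun x y => by
          have : (fun j => (x + y) (Fin.castAdd p j)) =
            (fun j => x (Fin.castAdd p j)) + (fun j => y (Fin.castAdd p j)) := rfl
          ext (v | w)
          · simp only [this, map_add]; simp
          · simp [add_mul, Finset.sum_add_distrib]
        map_smul' := fun r y => by
          have : (fun j => (r • y) (Fin.castAdd p j)) = r • (fun j => y (Fin.castAdd p j)) := rfl
          ext (v | w)
          · simp only [this, map_smul]; simp
          · simp [Finset.mul_sum, mul_assoc] }
    refine ⟨M, ?_⟩
    have hML : ∀ i y, M (liftMap m i y) = substMap u (a i) (π y) := by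
      intro i y
      ext (v | w)
      · simp [M, substMap]
      · simp only [M, substMap, LinearMap.coe_mk, AddHom.coe_mk, Sum.elim_inr, liftMap_natAdd, hmπ]
        rw [Finset.sum_eq_single i]
        · simp
        · intro b _ hb; simp [hb]
        · simp
    obtain ⟨F, hF, rfl⟩ := hQ
    rw [liftSet_eq hp F m hm, LinearMap.image_convexHull, Set.image_iUnion]
    have e1 : ∀ i, M '' (liftMap m i '' F) = substMap u (a i) '' (π '' F) := by
      intro i
      simp only [Set.image_image, hML]
    simp only [e1]
    rw [← convexHull_iUnion_congr]
    simp only [← LinearMap.image_convexHull]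
    rw [hπ]
    unfold stab
    simp only [LinearMap.image_convexHull]
    rw [convexHull_iUnion_congr, stab_subst G₁ u G₂ p hp a ha ha']


/-- if `G` is obtained by substituting the complete graph `K_p` (`p ≥ 1`)
in `G₁` at `u`, then `xc (STAB G) ≤ xc (STAB G₁) + p`; and if `G` is obtained by
substituting the two-vertex edgeless graph (the complement of `K₂`) in `G₁` at `u`, then
`xc (STAB G) ≤ xc (STAB G₁) + 3`. -/
theorem xc_stab_subst_complete_and_edgeless {V₁ : Type*} [Fintype V₁] [DecidableEq V₁]
    (G₁ : SimpleGraph V₁) (u : V₁) (p : ℕ) (hp : 1 ≤ p) :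
    xc (stab (substGraph G₁ u (⊤ : SimpleGraph (Fin p)))) ≤ xc (stab G₁) + p ∧
    xc (stab (substGraph G₁ u (⊥ : SimpleGraph (Fin 2)))) ≤ xc (stab G₁) + 3 := by
  constructor
  · refine xc_subst G₁ u _ p hp (fun i => {i}) ?_ ?_
    · intro i v hv w hw h
      rw [Set.mem_singleton_iff] at hv hw
      exact h.ne (hv.trans hw.symm)
    · rintro S ⟨i, hi⟩ hS
      refine ⟨i, ?_⟩
      ext j
      constructor
      · intro hj
        rw [Set.mem_singleton_iff] at hj
        rw [hj]; exact hi
      · intro hj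
        by_contra hne
        exact hS j hj i hi hne
  · refine xc_subst G₁ u _ 3 (by norm_num) ![{0}, {1}, {0, 1}] ?_ ?_
    · intro i v _ w _ h
      exact h
    · rintro S hS -
      by_cases h0 : (0 : Fin 2) ∈ S <;> by_cases h1 : (1 : Fin 2) ∈ S
      · refine ⟨2, ?_⟩
        ext j; fin_cases j <;> simp [h0, h1]
      · refine ⟨0, ?_⟩
        ext j; fin_cases j <;> simp [h0, h1]
      · refine ⟨1, ?_⟩
        ext j; fin_cases j <;> simp [h0, h1]
      · obtain ⟨j, hj⟩ := hS
        fin_cases j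
        · exact absurd hj h0
        · exact absurd hj h1
end

section
/- Let G = (V,E) be a perfect graph admitting a 2-join with partition (V₁, V₂) of V. Then xc(STAB(G)) ≤ 3·xc(STAB(G[V₁])) + 3·xc(STAB(G[V₂])). -/
/-- The clique number of a graph. -/
noncomputable def cliqueNum {V : Type*} (G : SimpleGraph V) : ℕ :=
  sSup {n : ℕ | ∃ s : Finset V, G.IsNClique n s}

/-- A graph is perfect if every induced subgraph has chromatic number equal to its
clique number. -/
def IsPerfect {V : Type*} (G : SimpleGraph V) : Prop :=
  ∀ S : Set V, (G.induce S).chromaticNumber = (cliqueNum (G.induce S) : ℕ∞)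

/-- A 2-join of `G` with parts `(V₁, V₂)`: there are disjoint nonempty `Aₖ, Bₖ ⊆ Vₖ` such
that every vertex of `A₁` is adjacent to every vertex of `A₂`, every vertex of `B₁` is
adjacent to every vertex of `B₂`, and there are no other edges between `V₁` and `V₂`. -/
def Is2Join {V : Type*} (G : SimpleGraph V) (V₁ V₂ : Set V) : Prop :=
  V₁ ∪ V₂ = Set.univ ∧ Disjoint V₁ V₂ ∧
  ∃ A₁ B₁ A₂ B₂ : Set V, A₁ ⊆ V₁ ∧ B₁ ⊆ V₁ ∧ A₂ ⊆ V₂ ∧ B₂ ⊆ V₂ ∧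
    A₁.Nonempty ∧ B₁.Nonempty ∧ A₂.Nonempty ∧ B₂.Nonempty ∧
    Disjoint A₁ B₁ ∧ Disjoint A₂ B₂ ∧
    (∀ a₁ ∈ A₁, ∀ a₂ ∈ A₂, G.Adj a₁ a₂) ∧
    (∀ b₁ ∈ B₁, ∀ b₂ ∈ B₂, G.Adj b₁ b₂) ∧
    (∀ v₁ ∈ V₁, ∀ v₂ ∈ V₂, G.Adj v₁ v₂ →
      (v₁ ∈ A₁ ∧ v₂ ∈ A₂) ∨ (v₁ ∈ B₁ ∧ v₂ ∈ B₂))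

/-- A skew partition of `G`: a partition of the vertices into nonempty sets
`(A₁, B₁, A₂, B₂)` with all edges present between `A₁` and `A₂` and no edges between
`B₁` and `B₂`. -/
def IsSkewPartition {V : Type*} (G : SimpleGraph V) (A₁ B₁ A₂ B₂ : Set V) : Prop :=
  A₁.Nonempty ∧ B₁.Nonempty ∧ A₂.Nonempty ∧ B₂.Nonempty ∧
  A₁ ∪ B₁ ∪ A₂ ∪ B₂ = Set.univ ∧
  Disjoint A₁ B₁ ∧ Disjoint A₁ A₂ ∧ Disjoint A₁ B₂ ∧
  Disjoint B₁ A₂ ∧ Disjoint B₁ B₂ ∧ Disjoint A₂ B₂ ∧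
  (∀ a₁ ∈ A₁, ∀ a₂ ∈ A₂, G.Adj a₁ a₂) ∧
  (∀ b₁ ∈ B₁, ∀ b₂ ∈ B₂, ¬ G.Adj b₁ b₂)

open Classical in
theorem perfect_cover {V : Type*} [Fintype V] (G : SimpleGraph V) (hG : IsPerfect G) :
    ∀ (n : ℕ) (w : V → ℕ) (k : ℕ), ∑ v, w v = n →
      (∀ K : Finset V, G.IsClique (K : Set V) → ∑ v ∈ K, w v ≤ k) →
      ∃ f : Fin k → Set V, (∀ i, ∀ u ∈ f i, ∀ v ∈ f i, ¬ G.Adj u v) ∧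
        ∀ v, ∑ i, (if v ∈ f i then 1 else 0) = w v := by
  intro n
  induction n using Nat.strong_induction_on with
  | _ n ih =>
  intro w k hn hK
  by_cases hw : ∀ v, w v ≤ 1
  · let S : Set V := {v | w v = 1}
    have hcl : cliqueNum (G.induce S) ≤ k := by
      unfold cliqueNum
      apply csSup_le'
      rintro m ⟨s, hs⟩
      have h1 := hK (s.map (Function.Embedding.subtype _)) (by
        intro a ha b hb hab
        simp only [Finset.coe_map, Set.mem_image, Finset.mem_coe] at ha hb
        obtain ⟨a, ha, rfl⟩ := ha
        obtain ⟨b, hb, rfl⟩ := hb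
        have := hs.1 ha hb (by rintro rfl; exact hab rfl)
        simpa using this)
      rw [Finset.sum_map] at h1
      have h2 : ∑ x ∈ s, w ((Function.Embedding.subtype _) x) = ∑ x ∈ s, 1 := by
        apply Finset.sum_congr rfl
        intro x _
        exact x.2
      rw [h2] at h1
      simpa [hs.2] using h1
    have hcol : (G.induce S).Colorable k := by
      rw [← SimpleGraph.chromaticNumber_le_iff_colorable, hG S]
      exact_mod_cast hcl
    obtain ⟨C⟩ := hcol
    refine ⟨fun i => {v | ∃ h : v ∈ S, C ⟨v, h⟩ = i}, ?_, ?_⟩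
    · rintro i u ⟨hu, hu'⟩ v ⟨hv, hv'⟩ huv
      exact C.valid (v := ⟨u, hu⟩) (w := ⟨v, hv⟩) (by simpa using huv) (hu'.trans hv'.symm)
    · intro v
      by_cases hv : v ∈ S
      · have : w v = 1 := hv
        simp [hv, this]
      · have h1 : w v ≠ 1 := hv
        have : w v = 0 := by have := hw v; omega
        simp [hv, this]
  · push Not at hw
    obtain ⟨v, hv⟩ := hw
    let w' : V → ℕ := fun u => if u = v then w u - 1 else w u
    have hw'le : ∀ u, w' u ≤ w u := by intro u; simp only [w']; split_ifs <;> omega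
    have hsum' : ∑ u, w' u < n := by
      rw [← hn]
      apply Finset.sum_lt_sum (fun u _ => hw'le u) ⟨v, Finset.mem_univ _, ?_⟩
      simp only [w', if_true]; omega
    obtain ⟨f, hf, hfw⟩ := ih _ hsum' w' k rfl
      (fun K h => (Finset.sum_le_sum (fun u _ => hw'le u)).trans (hK K h))
    obtain ⟨i0, hi0⟩ : ∃ i, v ∈ f i := by
      by_contra hcon
      push Not at hcon
      have := hfw v
      simp [hcon, w'] at this
      omega
    have hpos : ∀ u ∈ f i0, 1 ≤ w' u := by
      intro u hu
      rw [← hfw u]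
      calc 1 = (if u ∈ f i0 then 1 else 0) := by simp [hu]
        _ ≤ _ := Finset.single_le_sum (f := fun i => if u ∈ f i then 1 else 0)
          (fun i _ => Nat.zero_le _) (Finset.mem_univ i0)
    let w'' : V → ℕ := fun u => w u - if u ∈ f i0 then 1 else 0
    have hw''le : ∀ u, w'' u ≤ w u := by intro u; simp only [w'']; omega
    have hsum'' : ∑ u, w'' u < n := by
      rw [← hn]
      apply Finset.sum_lt_sum (fun u _ => hw''le u) ⟨v, Finset.mem_univ _, ?_⟩
      simp only [w'', hi0, if_true]; omega
    obtain ⟨k, rfl⟩ : ∃ m, k = m + 1 := ⟨k - 1, by have := i0.2; omega⟩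
    have hK'' : ∀ K : Finset V, G.IsClique (K : Set V) → ∑ v ∈ K, w'' v ≤ k := by
      intro K hKc
      have hlt : ∀ u ∈ K, u ∈ f i0 → ∑ u ∈ K, w'' u ≤ k := by
        intro u hu huf
        have : ∑ u ∈ K, w'' u < ∑ u ∈ K, w u := by
          apply Finset.sum_lt_sum (fun u _ => hw''le u) ⟨u, hu, ?_⟩
          have := hpos u huf
          have := hw'le u
          simp only [w'', huf, if_true]; omega
        have := hK K hKc
        omega
      by_cases hex : ∃ u ∈ K, u ∈ f i0
      · obtain ⟨u, hu, huf⟩ := hex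
        exact hlt u hu huf
      · push Not at hex
        have e1 : ∑ u ∈ K, w'' u = ∑ u ∈ K, w' u := by
          apply Finset.sum_congr rfl
          intro u hu
          have : u ≠ v := by rintro rfl; exact hex _ hu hi0
          simp [w'', w', this, hex u hu]
        rw [e1, ← Finset.sum_congr rfl (fun u _ => hfw u), Finset.sum_comm]
        have : ∑ i, ∑ u ∈ K, (if u ∈ f i then 1 else 0) < ∑ i : Fin (k+1), 1 := by
          apply Finset.sum_lt_sum
          · intro i _
            rw [← Finset.sum_filter, Finset.sum_const, smul_eq_mul, mul_one, Finset.card_le_one]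
            intro a ha b hb
            simp only [Finset.mem_filter] at ha hb
            by_contra hab
            exact hf i a ha.2 b hb.2 (hKc ha.1 hb.1 hab)
          · refine ⟨i0, Finset.mem_univ _, ?_⟩
            rw [Finset.sum_eq_zero]
            · simp
            · intro u hu; simp [hex u hu]
        simp at this
        simp
        omega
    obtain ⟨g, hg, hgw⟩ := ih _ hsum'' w'' k rfl hK''
    refine ⟨Fin.cons (f i0) g, ?_, ?_⟩
    · intro i
      refine Fin.cases ?_ ?_ i
      · simpa using hf i0
      · intro j; simpa using hg j
    · intro u
      rw [Fin.sum_univ_succ]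
      simp only [Fin.cons_zero, Fin.cons_succ]
      rw [hgw u]
      simp only [w'']
      split_ifs with h
      · have := hpos u h
        have := hw'le u
        omega
      · omega

theorem stab_finite {V : Type*} [Fintype V] (G : SimpleGraph V) :
    {x : V → ℝ | ∃ S : Set V, (∀ u ∈ S, ∀ v ∈ S, ¬ G.Adj u v) ∧ x = S.indicator 1}.Finite := by
  apply (Set.finite_range (fun S : Set V => (S.indicator 1 : V → ℝ))).subset
  rintro x ⟨S, _, rfl⟩
  exact ⟨S, rfl⟩

theorem mem_stab_of_clique {V : Type*} [Fintype V] (G : SimpleGraph V) (hG : IsPerfect G)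
    (x : V → ℝ) (hx : ∀ v, 0 ≤ x v)
    (hK : ∀ K : Finset V, G.IsClique (K : Set V) → ∑ v ∈ K, x v ≤ 1) : x ∈ stab G := by
  classical
  have hclosed : IsClosed (stab G) := (stab_finite G).isClosed_convexHull ℝ
  have key : ∀ N : ℕ, (fun v => (⌊x v * ((N : ℝ) + 1)⌋₊ : ℝ) / ((N : ℝ) + 1)) ∈ stab G := by
    intro N
    have hN : (0 : ℝ) < (N : ℝ) + 1 := by positivity
    obtain ⟨f, hf, hfw⟩ := perfect_cover G hG _ (fun v => ⌊x v * ((N : ℝ) + 1)⌋₊) (N + 1) rfl (by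
      intro K hKc
      have h1 : ∑ v ∈ K, (⌊x v * ((N : ℝ) + 1)⌋₊ : ℝ) ≤ (N : ℝ) + 1 := by
        calc ∑ v ∈ K, (⌊x v * ((N : ℝ) + 1)⌋₊ : ℝ) ≤ ∑ v ∈ K, x v * ((N : ℝ) + 1) :=
              Finset.sum_le_sum (fun v _ => Nat.floor_le (mul_nonneg (hx v) hN.le))
          _ = (∑ v ∈ K, x v) * ((N : ℝ) + 1) := by rw [Finset.sum_mul]
          _ ≤ 1 * ((N : ℝ) + 1) := by
              apply mul_le_mul_of_nonneg_right (hK K hKc) hN.le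
          _ = _ := one_mul _
      exact_mod_cast h1)
    have : (fun v => (⌊x v * ((N : ℝ) + 1)⌋₊ : ℝ) / ((N : ℝ) + 1)) =
        ∑ i : Fin (N + 1), (1 / ((N : ℝ) + 1)) • ((f i).indicator 1 : V → ℝ) := by
      funext v
      rw [← hfw v]
      simp only [Finset.sum_apply, Pi.smul_apply, smul_eq_mul, ← Finset.mul_sum]
      push_cast
      rw [div_eq_mul_one_div, mul_comm]
      simp [Set.indicator_apply]
    rw [this]
    apply (convex_convexHull ℝ _).sum_mem
    · intro i _; positivity
    · simp; field_simp
    · intro i _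
      exact subset_convexHull ℝ _ ⟨f i, hf i, rfl⟩
  apply hclosed.mem_of_tendsto (f := fun N : ℕ =>
    (fun v => (⌊x v * ((N : ℝ) + 1)⌋₊ : ℝ) / ((N : ℝ) + 1))) (b := Filter.atTop) ?_
    (Filter.Eventually.of_forall key)
  rw [tendsto_pi_nhds]
  intro v
  have h1 := tendsto_nat_floor_mul_div_atTop (R := ℝ) (hx v)
  have h2 : Filter.Tendsto (fun N : ℕ => (N : ℝ) + 1) Filter.atTop Filter.atTop :=
    Filter.tendsto_atTop_add_const_right _ _ tendsto_natCast_atTop_atTop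
  exact h1.comp h2

theorem stab_nonneg {V : Type*} [Fintype V] (G : SimpleGraph V) {x : V → ℝ} (hx : x ∈ stab G)
    (v : V) : 0 ≤ x v := by
  have hc : Convex ℝ {x : V → ℝ | 0 ≤ x v} := by
    intro a ha b hb s t hs ht _
    simp only [Set.mem_ofPred_eq, Pi.add_apply, Pi.smul_apply, smul_eq_mul] at *
    positivity
  refine convexHull_min ?_ hc hx
  rintro x ⟨S, _, rfl⟩
  exact Set.indicator_nonneg (f := (1 : V → ℝ)) (by intro _ _; simp) v

theorem stab_clique {V : Type*} [Fintype V] (G : SimpleGraph V) {x : V → ℝ} (hx : x ∈ stab G)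
    (K : Finset V) (hK : G.IsClique (K : Set V)) : ∑ v ∈ K, x v ≤ 1 := by
  classical
  have hc : Convex ℝ {x : V → ℝ | ∑ v ∈ K, x v ≤ 1} := by
    intro a ha b hb s t hs ht hst
    simp only [Set.mem_ofPred_eq, Pi.add_apply, Pi.smul_apply, smul_eq_mul,
      Finset.sum_add_distrib, ← Finset.mul_sum] at *
    nlinarith
  refine convexHull_min ?_ hc hx
  rintro x ⟨S, hS, rfl⟩
  simp only [Set.mem_ofPred_eq, Set.indicator_apply, Pi.one_apply]
  rw [← Finset.sum_filter, Finset.sum_const, nsmul_eq_mul, mul_one]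
  have : (Finset.filter (fun v => v ∈ S) K).card ≤ 1 := by
    rw [Finset.card_le_one]
    intro a ha b hb
    simp only [Finset.mem_filter] at ha hb
    by_contra hab
    exact hS a ha.2 b hb.2 (hK ha.1 hb.1 hab)
  exact_mod_cast this

theorem exists_coeff {κ : Type*} [Fintype κ] (l : (κ → ℝ) →ₗ[ℝ] ℝ) :
    ∃ c : κ → ℝ, ∀ y, ∑ i, c i * y i = l y := by
  classical
  refine ⟨fun i => l (Pi.single i 1), fun y => ?_⟩
  rw [LinearMap.pi_apply_eq_sum_univ l y]
  apply Finset.sum_congr rfl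
  intro i _
  rw [smul_eq_mul, mul_comm]
  congr 1
  show l _ = l _
  congr 1
  funext j
  simp [Pi.single_apply, eq_comm]

/-- The linear functional with given coefficients. -/
noncomputable def coeffFun {κ : Type*} [Fintype κ] (c : κ → ℝ) : (κ → ℝ) →ₗ[ℝ] ℝ where
  toFun y := ∑ i, c i * y i
  map_add' x y := by simp [mul_add, Finset.sum_add_distrib]
  map_smul' t x := by
    simp only [Pi.smul_apply, smul_eq_mul, RingHom.id_apply, Finset.mul_sum]
    apply Finset.sum_congr rfl
    intro i _
    ring

theorem coeffFun_apply {κ : Type*} [Fintype κ] (c y : κ → ℝ) :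
    coeffFun c y = ∑ i, c i * y i := rfl

theorem perturb {E I : Type*} [AddCommGroup E] [Module ℝ E] [Finite I] (L : Set E)
    (hL : ∀ p ∈ L, ∀ q ∈ L, ∀ t : ℝ, p + t • (p - q) ∈ L) (l : I → E →ₗ[ℝ] ℝ)
    (y q : E) (hyL : y ∈ L) (hqL : q ∈ L) (hy : ∀ i, 0 ≤ l i y)
    (h : ∀ i, l i y = 0 → l i q = 0) :
    ∃ ε : ℝ, 0 < ε ∧ y + ε • (y - q) ∈ L ∧ ∀ i, 0 ≤ l i (y + ε • (y - q)) := by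
  have h1 : ∀ i, ∀ᶠ ε : ℝ in nhdsWithin 0 (Set.Ioi 0), 0 ≤ l i (y + ε • (y - q)) := by
    intro i
    by_cases hi : l i y = 0
    · refine Filter.Eventually.of_forall fun ε => ?_
      simp [hi, h i hi]
    · have hpos : 0 < l i y := lt_of_le_of_ne (hy i) (Ne.symm hi)
      have ht : Filter.Tendsto (fun ε : ℝ => l i y + ε * (l i y - l i q))
          (nhdsWithin 0 (Set.Ioi 0)) (nhds (l i y + 0 * (l i y - l i q))) := by
        apply Filter.Tendsto.mono_left _ nhdsWithin_le_nhds
        apply Continuous.tendsto (f := fun ε : ℝ => l i y + ε * (l i y - l i q))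
        fun_prop
      have := ht.eventually (lt_mem_nhds (a := 0) (by simpa using hpos))
      filter_upwards [this] with ε hε
      simpa using hε.le
  have h2 := (Filter.eventually_all.2 h1).and
    (self_mem_nhdsWithin : Set.Ioi (0 : ℝ) ∈ nhdsWithin 0 (Set.Ioi 0))
  obtain ⟨ε, hε, hε0⟩ := h2.exists
  exact ⟨ε, hε0, hL y hyL q hqL ε, hε⟩

theorem polySize_le {κ I : Type*} [Fintype κ] [Fintype I] (L : Set (κ → ℝ))
    (hL : ∀ p ∈ L, ∀ q ∈ L, ∀ t : ℝ, p + t • (p - q) ∈ L) (l : I → (κ → ℝ) →ₗ[ℝ] ℝ)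
    (Q : Set (κ → ℝ)) (hQ : ∀ y, y ∈ Q ↔ y ∈ L ∧ ∀ i, 0 ≤ l i y) :
    polySize Q ≤ Fintype.card I := by
  classical
  have hQc : Convex ℝ Q := by
    intro p hp q hq a b ha hb hab
    rw [hQ] at *
    refine ⟨?_, fun i => ?_⟩
    · have := hL p hp.1 q hq.1 (-b)
      convert this using 1
      obtain rfl : a = 1 - b := by linarith
      module
    · simp only [map_add, map_smul, smul_eq_mul]
      have := hp.2 i
      have := hq.2 i
      positivity
  have key : {F : Set (κ → ℝ) | IsFacet Q F} ⊆
      Set.range (fun i => {y | y ∈ Q ∧ l i y = 0}) := by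
    rintro f ⟨⟨hfQ, c, α, hc, hf⟩, hne, hfne, hmax⟩
    have hfc : ∀ y, y ∈ f ↔ y ∈ Q ∧ coeffFun c y = α := by
      intro y; rw [hf]; rfl
    have hy : ∀ s : Finset I, ∃ y ∈ f, ∀ i ∈ s, l i y = 0 → ∀ y' ∈ f, l i y' = 0 := by
      intro s
      induction s using Finset.induction_on with
      | empty => obtain ⟨y, hy⟩ := hne; exact ⟨y, hy, by simp⟩
      | insert i s _ ih =>
        obtain ⟨y, hy, hys⟩ := ih
        by_cases hex : ∃ p ∈ f, l i p ≠ 0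
        · obtain ⟨p, hp, hpi⟩ := hex
          have hyQ := (hQ y).1 (hfQ hy)
          have hpQ := (hQ p).1 (hfQ hp)
          refine ⟨(1/2 : ℝ) • y + (1/2 : ℝ) • p, ?_, ?_⟩
          · rw [hfc] at *
            refine ⟨hQc hy.1 hp.1 (by norm_num) (by norm_num) (by norm_num), ?_⟩
            simp only [map_add, map_smul, smul_eq_mul, hy.2, hp.2]
            ring
          · intro j hj hj0
            simp only [map_add, map_smul, smul_eq_mul] at hj0
            have a1 := hyQ.2 j
            have a2 := hpQ.2 j
            have b1 : l j y = 0 := by linarith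
            have b2 : l j p = 0 := by linarith
            rcases Finset.mem_insert.1 hj with rfl | hj
            · exact absurd b2 hpi
            · exact hys j hj b1
        · push Not at hex
          refine ⟨y, hy, fun j hj hj0 => ?_⟩
          rcases Finset.mem_insert.1 hj with rfl | hj
          · exact hex
          · exact hys j hj hj0
    obtain ⟨y, hyf, hy⟩ := hy Finset.univ
    have hyQ := (hQ y).1 (hfQ hyf)
    have hyc := ((hfc y).1 hyf).2
    by_cases hex : ∃ i, l i y = 0 ∧ ∃ q ∈ Q, l i q ≠ 0
    · obtain ⟨i, hi, q, hq, hqi⟩ := hex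
      refine ⟨i, hmax _ ?_ ?_ ?_ ?_⟩
      · refine ⟨fun y h => h.1, ?_⟩
        obtain ⟨c', hc'⟩ := exists_coeff (-(l i))
        refine ⟨c', 0, ?_, ?_⟩
        · intro y hy
          rw [hc']
          simpa using ((hQ y).1 hy).2 i
        · ext z
          simp [hc']
      · exact ⟨y, hfQ hyf, hi⟩
      · intro heq
        have : q ∈ {y | y ∈ Q ∧ l i y = 0} := heq.ge hq
        exact hqi this.2
      · intro z hz
        exact ⟨hfQ hz, hy i (Finset.mem_univ _) hi z hz⟩
    · push Not at hex
      exfalso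
      apply hfne
      apply Set.Subset.antisymm hfQ
      intro q hq
      have hqQ := (hQ q).1 hq
      obtain ⟨ε, hε, h1, h2⟩ := perturb L hL l y q hyQ.1 hqQ.1 hyQ.2 (fun i hi => hex i hi q hq)
      have h3 : coeffFun c (y + ε • (y - q)) ≤ α := hc _ ((hQ _).2 ⟨h1, h2⟩)
      rw [hfc]
      refine ⟨hq, le_antisymm (hc q hq) ?_⟩
      simp only [map_add, map_smul, map_sub, smul_eq_mul, hyc] at h3
      by_contra hlt
      push Not at hlt
      nlinarith [mul_pos hε (sub_pos.2 hlt)]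
  unfold polySize
  calc _ ≤ (Set.range (fun i => {y | y ∈ Q ∧ l i y = 0})).ncard :=
        Set.ncard_le_ncard key (Set.finite_range _)
    _ = Nat.card (Set.range (fun i => {y | y ∈ Q ∧ l i y = 0})) := rfl
    _ ≤ Nat.card I := Finite.card_range_le _
    _ = _ := Nat.card_eq_fintype_card

theorem isPolytope_of_compact {E I : Type*} [NormedAddCommGroup E] [NormedSpace ℝ E]
    [FiniteDimensional ℝ E] [Finite I] (L : Set E)
    (hL : ∀ p ∈ L, ∀ q ∈ L, ∀ t : ℝ, p + t • (p - q) ∈ L) (l : I → E →ₗ[ℝ] ℝ)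
    (Q : Set E) (hQ : ∀ y, y ∈ Q ↔ y ∈ L ∧ ∀ i, 0 ≤ l i y) (hcomp : IsCompact Q) :
    Convex ℝ Q ∧ IsPolytope Q := by
  have hQc : Convex ℝ Q := by
    intro p hp q hq a b ha hb hab
    rw [hQ] at *
    refine ⟨?_, fun i => ?_⟩
    · have := hL p hp.1 q hq.1 (-b)
      convert this using 1
      obtain rfl : a = 1 - b := by linarith
      module
    · simp only [map_add, map_smul, smul_eq_mul]
      have := hp.2 i
      have := hq.2 i
      positivity
  have hfin : (Q.extremePoints ℝ).Finite := by
    apply Set.Finite.of_finite_image (f := fun p => {i | l i p = 0}) (Set.toFinite _)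
    intro p hp q hq hpq
    have hpQ := (hQ p).1 hp.1
    have hqQ := (hQ q).1 hq.1
    obtain ⟨ε, hε, h1, h2⟩ := perturb L hL l p q hpQ.1 hqQ.1 hpQ.2 (fun i hi => by
      have : i ∈ {i | l i p = 0} := hi
      simp only at hpq
      rw [hpq] at this
      exact this)
    have h3 := (mem_extremePoints.1 hp).2 _ ((hQ _).2 ⟨h1, h2⟩) _ hq.1 (by
      refine ⟨1 / (1 + ε), ε / (1 + ε), by positivity, by positivity, by field_simp, ?_⟩
      have e : (1 / (1 + ε) : ℝ) + 1 / (1 + ε) * ε = 1 := by field_simp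
      have e2 : ε / (1 + ε) = 1 / (1 + ε) * ε := by ring
      rw [e2]
      calc _ = ((1 / (1 + ε) : ℝ) + 1 / (1 + ε) * ε) • p := by module
        _ = p := by rw [e, one_smul])
    exact h3.2.symm
  refine ⟨hQc, Q.extremePoints ℝ, hfin, ?_⟩
  rw [← (hfin.isClosed_convexHull ℝ).closure_eq]
  exact (closure_convexHull_extremePoints hcomp hQc).symm

theorem xc_le_of_rep {ι F I : Type*} [Fintype ι] [NormedAddCommGroup F] [NormedSpace ℝ F]
    [FiniteDimensional ℝ F] [Fintype I] (L : Set F)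
    (hL : ∀ p ∈ L, ∀ q ∈ L, ∀ t : ℝ, p + t • (p - q) ∈ L) (l : I → F →ₗ[ℝ] ℝ)
    (Q : Set F) (hQ : ∀ y, y ∈ Q ↔ y ∈ L ∧ ∀ i, 0 ≤ l i y) (hcomp : IsCompact Q)
    (P : Set (ι → ℝ)) (π : F →ₗ[ℝ] (ι → ℝ)) (hπ : π '' Q = P) : xc P ≤ Fintype.card I := by
  let e : (Fin (Module.finrank ℝ F) → ℝ) ≃L[ℝ] F :=
    ContinuousLinearEquiv.ofFinrankEq (by simp)
  have hL' : ∀ p ∈ e ⁻¹' L, ∀ q ∈ e ⁻¹' L, ∀ t : ℝ, p + t • (p - q) ∈ e ⁻¹' L := by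
    intro p hp q hq t
    simp only [Set.mem_preimage, map_add, map_smul, map_sub] at *
    exact hL _ hp _ hq t
  have hQ' : ∀ y, y ∈ e ⁻¹' Q ↔ y ∈ e ⁻¹' L ∧ ∀ i, 0 ≤ ((l i).comp e.toLinearMap) y := by
    intro y
    exact hQ (e y)
  have hcomp' : IsCompact (e ⁻¹' Q) := by
    have := e.toHomeomorph.isCompact_preimage (s := Q)
    exact this.2 hcomp
  refine le_trans (Nat.sInf_le ?_) (polySize_le (e ⁻¹' L) hL' _ (e ⁻¹' Q) hQ')
  refine ⟨_, e ⁻¹' Q, ⟨(isPolytope_of_compact _ hL' _ _ hQ' hcomp').2, π.comp e.toLinearMap, ?_⟩,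
    rfl⟩
  rw [← hπ]
  ext x
  constructor
  · rintro ⟨y, hy, rfl⟩
    exact ⟨e y, hy, rfl⟩
  · rintro ⟨y, hy, rfl⟩
    exact ⟨e.symm y, by simpa using hy, by simp⟩

theorem face_eq_hull {κ : Type*} [Fintype κ] (F f : Set (κ → ℝ))
    (hf : IsExposedFace (convexHull ℝ F) f) : f = convexHull ℝ (F ∩ f) := by
  obtain ⟨hfQ, c, α, hc, hfe⟩ := hf
  have hfc : ∀ y, y ∈ f ↔ y ∈ convexHull ℝ F ∧ coeffFun c y = α := by
    intro y; rw [hfe]; rfl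
  have hc' : ∀ y ∈ convexHull ℝ F, coeffFun c y ≤ α := hc
  apply Set.Subset.antisymm
  · intro y hy
    have hT : Convex ℝ {y | coeffFun c y ≤ α ∧ (coeffFun c y = α → y ∈ convexHull ℝ (F ∩ f))} := by
      intro p hp q hq a b ha hb hab
      simp only [Set.mem_ofPred_eq, map_add, map_smul, smul_eq_mul] at *
      have e : α = a * α + b * α := by rw [← add_mul, hab, one_mul]
      have m1 := mul_le_mul_of_nonneg_left hp.1 ha
      have m2 := mul_le_mul_of_nonneg_left hq.1 hb
      refine ⟨by linarith, fun h => ?_⟩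
      rcases ha.eq_or_lt with rfl | ha'
      · obtain rfl : b = 1 := by linarith
        simpa using hq.2 (by linarith)
      rcases hb.eq_or_lt with rfl | hb'
      · obtain rfl : a = 1 := by linarith
        simpa using hp.2 (by linarith)
      · have e1 : coeffFun c p = α := by
          apply le_antisymm hp.1
          by_contra hlt
          push Not at hlt
          have := mul_lt_mul_of_pos_left hlt ha'
          linarith
        have e2 : coeffFun c q = α := by
          apply le_antisymm hq.1
          by_contra hlt
          push Not at hlt
          have := mul_lt_mul_of_pos_left hlt hb'
          linarith
        exact convex_convexHull ℝ _ (hp.2 e1) (hq.2 e2) ha hb hab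
    have hsub := convexHull_min (s := F) (fun v hv => ?_) hT
    · exact (hsub (hfQ hy)).2 ((hfc y).1 hy).2
    · have hv' := subset_convexHull ℝ F hv
      exact ⟨hc' v hv', fun h => subset_convexHull ℝ _ ⟨hv, (hfc v).2 ⟨hv', h⟩⟩⟩
  · apply convexHull_min Set.inter_subset_right
    intro p hp q hq a b ha hb hab
    rw [hfc] at *
    refine ⟨convex_convexHull ℝ _ hp.1 hq.1 ha hb hab, ?_⟩
    simp only [map_add, map_smul, smul_eq_mul, hp.2, hq.2]
    rw [← add_mul, hab, one_mul]

theorem faces_finite {κ : Type*} [Fintype κ] (F : Set (κ → ℝ)) (hF : F.Finite) :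
    {f | IsExposedFace (convexHull ℝ F) f}.Finite := by
  apply (hF.powerset.image (fun A => convexHull ℝ A)).subset
  intro f hf
  exact ⟨F ∩ f, Set.inter_subset_left, (face_eq_hull F f hf).symm⟩

theorem exists_facet {κ : Type*} [Fintype κ] (F : Set (κ → ℝ)) (hF : F.Finite) (f : Set (κ → ℝ))
    (hf : IsExposedFace (convexHull ℝ F) f) (hne : f.Nonempty) (hp : f ≠ convexHull ℝ F) :
    ∃ Φ, IsFacet (convexHull ℝ F) Φ ∧ f ⊆ Φ := by
  have hfin : {f | IsExposedFace (convexHull ℝ F) f ∧ f.Nonempty ∧ f ≠ convexHull ℝ F}.Finite :=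
    (faces_finite F hF).subset (fun f h => h.1)
  obtain ⟨m, hfm, hm⟩ := hfin.exists_le_maximal (a := f) ⟨hf, hne, hp⟩
  refine ⟨m, ⟨hm.1.1, hm.1.2.1, hm.1.2.2, ?_⟩, hfm⟩
  intro F' h1 h2 h3 h4
  exact Set.Subset.antisymm (hm.2 ⟨h1, h2, h3⟩ h4) h4

theorem exit_facet {κ : Type*} [Fintype κ] (F : Set (κ → ℝ)) (hF : F.Finite)
    (y0 : κ → ℝ) (hy0 : y0 ∈ convexHull ℝ F) (y : κ → ℝ) (hy : y ∉ convexHull ℝ F)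
    (hyW : y - y0 ∈ Submodule.span ℝ {d | y0 + d ∈ convexHull ℝ F}) :
    ∃ Φ, IsFacet (convexHull ℝ F) Φ ∧ ∀ c α, (∀ q ∈ convexHull ℝ F, coeffFun c q ≤ α) →
      (∀ q, q ∈ Φ ↔ q ∈ convexHull ℝ F ∧ coeffFun c q = α) → α < coeffFun c y := by
  have hclosed := hF.isClosed_convexHull ℝ
  have hconv := convex_convexHull ℝ F
  set Q := convexHull ℝ F with hQ
  set s : Set (κ → ℝ) := {d | y0 + d ∈ Q} with hs
  let W := Submodule.span ℝ s
  let S : Set W := (fun w : W => (w : κ → ℝ)) ⁻¹' s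
  have hS : ∀ w : W, w ∈ S ↔ y0 + (w : κ → ℝ) ∈ Q := fun w => Iff.rfl
  have hSconv : Convex ℝ S := by
    intro p hp q hq a b ha hb hab
    rw [hS] at *
    have := hconv hp hq ha hb hab
    convert this using 1
    push_cast
    have e : y0 = (a + b) • y0 := by rw [hab, one_smul]
    nth_rewrite 1 [e]
    module
  have hSclosed : IsClosed S := by
    have : Continuous (fun w : W => y0 + (w : κ → ℝ)) := by fun_prop
    exact hclosed.preimage this
  have h0S : (0 : W) ∈ S := by rw [hS]; simpa using hy0
  have hint : (interior S).Nonempty := by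
    rw [hSconv.interior_nonempty_iff_affineSpan_eq_top]
    have h1 : insert 0 S = S := Set.insert_eq_of_mem h0S
    have h2 : Submodule.span ℝ S = ⊤ := Submodule.span_span_coe_preimage
    apply SetLike.coe_injective
    rw [← h1, affineSpan_insert_zero, h2]
    rfl
  obtain ⟨z, hz⟩ := hint
  have hzS := interior_subset hz
  let y' : W := ⟨y - y0, hyW⟩
  have hy'S : y' ∉ S := by
    rw [hS]
    simpa [y'] using hy
  obtain ⟨w, hwseg, hwfr⟩ : (segment ℝ z y' ∩ frontier S).Nonempty := by
    have hpre : IsPreconnected (segment ℝ z y') := (convex_segment z y').isPreconnected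
    by_contra hcon
    rw [Set.not_nonempty_iff_eq_empty] at hcon
    have hsub : segment ℝ z y' ⊆ interior S := by
      apply hpre.subset_left_of_subset_union isOpen_interior hSclosed.isOpen_compl
      · exact Set.disjoint_left.2 (fun a ha hb => hb (interior_subset ha))
      · intro a ha
        by_cases haS : a ∈ S
        · left
          by_contra hai
          have : a ∈ segment ℝ z y' ∩ frontier S := ⟨ha, subset_closure haS, hai⟩
          rw [hcon] at this
          exact this
        · right; exact haS
      · exact ⟨z, left_mem_segment ℝ z y', hz⟩
    exact hy'S (interior_subset (hsub (right_mem_segment ℝ z y')))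
  have hwS : w ∈ S := by
    have := hwfr.1
    rwa [hSclosed.closure_eq] at this
  obtain ⟨g, hg⟩ := geometric_hahn_banach_open_point hSconv.interior isOpen_interior hwfr.2
  have hgS : ∀ a ∈ S, g a ≤ g w := by
    intro a ha
    have hcl : closure (interior S) ⊆ {a | g a ≤ g w} :=
      closure_minimal (fun a ha => (hg a ha).le) (isClosed_le g.continuous continuous_const)
    apply hcl
    rw [hSconv.closure_interior_eq_closure_of_nonempty_interior ⟨z, hz⟩]
    exact subset_closure ha
  obtain ⟨G, hG⟩ := LinearMap.exists_extend (g : W →ₗ[ℝ] ℝ)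
  have hG' : ∀ a : W, G a = g a := fun a => by
    have := LinearMap.congr_fun hG a
    simpa using this
  obtain ⟨c, hc⟩ := exists_coeff G
  have hmem : ∀ q ∈ Q, ∃ a : W, a ∈ S ∧ q = y0 + (a : κ → ℝ) := by
    intro q hq
    have hqs : q - y0 ∈ s := by simpa [hs] using hq
    exact ⟨⟨q - y0, Submodule.subset_span hqs⟩, hqs, by simp⟩
  obtain ⟨Φ, hΦ, hfΦ⟩ := exists_facet F hF {q | q ∈ Q ∧ ∑ i, c i * q i = G (y0 + w)}
    (by
      refine ⟨fun q h => h.1, c, G (y0 + w), ?_, rfl⟩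
      intro q hq
      obtain ⟨a, ha, rfl⟩ := hmem q hq
      rw [hc, map_add, map_add, hG', hG']
      linarith [hgS a ha])
    ⟨y0 + w, hwS, hc _⟩
    (by
      intro heq
      have : y0 + (z : κ → ℝ) ∈ {q | q ∈ Q ∧ ∑ i, c i * q i = G (y0 + w)} := by
        rw [heq]; exact hzS
      have h2 := this.2
      rw [hc, map_add, map_add, hG', hG'] at h2
      have := hg z hz
      linarith)
  refine ⟨Φ, hΦ, fun c' α' hval hΦe => ?_⟩
  have hw1 : coeffFun c' (y0 + w) = α' := ((hΦe _).1 (hfΦ ⟨hwS, hc _⟩)).2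
  have hz1 : coeffFun c' (y0 + z) < α' := by
    apply lt_of_le_of_ne (hval _ hzS)
    intro heq
    apply hΦ.2.2.1
    apply Set.Subset.antisymm (fun q hq => ((hΦe q).1 hq).1)
    intro q hq
    obtain ⟨a, ha, rfl⟩ := hmem q hq
    have hev : ∀ᶠ ε : ℝ in nhdsWithin 0 (Set.Ioi 0), z + ε • (z - a) ∈ S := by
      have ht : Filter.Tendsto (fun ε : ℝ => z + ε • (z - a))
          (nhdsWithin 0 (Set.Ioi 0)) (nhds (z + (0 : ℝ) • (z - a))) := by
        apply Filter.Tendsto.mono_left _ nhdsWithin_le_nhds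
        apply Continuous.tendsto (f := fun ε : ℝ => z + ε • (z - a))
        fun_prop
      apply ht.eventually
      rw [zero_smul, add_zero]
      exact mem_interior_iff_mem_nhds.1 hz
    obtain ⟨ε, hε, hε0⟩ := (hev.and
      (self_mem_nhdsWithin : Set.Ioi (0 : ℝ) ∈ nhdsWithin 0 (Set.Ioi 0))).exists
    have hε0 : 0 < ε := hε0
    have h3 := hval _ ((hS _).1 hε)
    rw [hΦe]
    refine ⟨hq, le_antisymm (hval _ hq) ?_⟩
    push_cast at h3
    simp only [map_add, map_smul, map_sub, smul_eq_mul] at h3 heq ⊢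
    by_contra hlt
    push Not at hlt
    nlinarith [mul_pos hε0 (sub_pos.2 hlt)]
  obtain ⟨a, b, ha, hb, hab, hw⟩ := hwseg
  have hyy : y = y0 + (y' : κ → ℝ) := by simp [y']
  by_contra hle
  push Not at hle
  rw [hyy, map_add] at hle
  have hw2 : (w : κ → ℝ) = a • (z : κ → ℝ) + b • (y' : κ → ℝ) := by rw [← hw]; rfl
  rw [hw2] at hw1
  simp only [map_add, map_smul, smul_eq_mul] at hw1 hz1
  rcases ha.eq_or_lt with rfl | ha'
  · obtain rfl : b = 1 := by linarith
    apply hy'S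
    have : w = y' := by rw [← hw]; simp
    rw [← this]; exact hwS
  · obtain rfl : b = 1 - a := by linarith
    nlinarith [mul_lt_mul_of_pos_left hz1 ha', mul_le_mul_of_nonneg_left hle hb]

/-- `P` has a slack representation with inequalities indexed by `I`. -/
def SlackRep {ι I : Type*} (P : Set (ι → ℝ)) (z0 : (ι → ℝ) × (I → ℝ))
    (D : Submodule ℝ ((ι → ℝ) × (I → ℝ))) (R : ℝ) : Prop :=
  (∀ x, x ∈ P ↔ ∃ s : I → ℝ, (∀ i, 0 ≤ s i) ∧ (x, s) - z0 ∈ D) ∧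
    ∀ x (s : I → ℝ), (∀ i, 0 ≤ s i) → (x, s) - z0 ∈ D → ∀ i, s i ≤ R

theorem exists_slackRep {ι : Type*} [Fintype ι] (P : Set (ι → ℝ)) (hP : IsPolytope P)
    (hne : P.Nonempty) : ∃ (I : Type) (_ : Fintype I) (z0 : (ι → ℝ) × (I → ℝ))
    (D : Submodule ℝ ((ι → ℝ) × (I → ℝ))) (R : ℝ), Fintype.card I = xc P ∧ SlackRep P z0 D R := by
  have hset : {r : ℕ | ∃ (k : ℕ) (Q : Set (Fin k → ℝ)), IsExtension P Q ∧ polySize Q = r}.Nonempty := by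
    obtain ⟨F, hF, rfl⟩ := hP
    let e : (Fin (Fintype.card ι) → ℝ) ≃ₗ[ℝ] (ι → ℝ) :=
      LinearEquiv.funCongrLeft ℝ ℝ (Fintype.equivFin ι)
    refine ⟨_, _, convexHull ℝ (e.symm '' F), ⟨⟨_, hF.image _, rfl⟩, e.toLinearMap, ?_⟩, rfl⟩
    rw [LinearMap.image_convexHull]
    congr 1
    rw [← Set.image_comp]
    convert Set.image_id _
    ext x
    simp
  obtain ⟨k, Q, ⟨⟨F, hF, rfl⟩, π, hπ⟩, hr⟩ := Nat.sInf_mem hset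
  obtain ⟨y0, hy0⟩ : (convexHull ℝ F).Nonempty := by
    rw [← hπ] at hne
    exact Set.image_nonempty.1 hne
  have hfin : {f | IsFacet (convexHull ℝ F) f}.Finite :=
    (faces_finite F hF).subset (fun f h => h.1)
  let I := ↥{f | IsFacet (convexHull ℝ F) f}
  have : Fintype I := hfin.fintype
  have hex : ∀ i : I, ∃ c α, (∀ q ∈ convexHull ℝ F, coeffFun c q ≤ α) ∧
      (∀ q, q ∈ i.1 ↔ q ∈ convexHull ℝ F ∧ coeffFun c q = α) := by
    rintro ⟨Φ, hΦ⟩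
    obtain ⟨⟨h1, c, α, h2, h3⟩, _⟩ := hΦ
    exact ⟨c, α, h2, fun q => by simp only; rw [h3]; rfl⟩
  choose c α hc hcΦ using hex
  let T : (Fin k → ℝ) →ₗ[ℝ] ((ι → ℝ) × (I → ℝ)) :=
    π.prod (LinearMap.pi (fun i => -(coeffFun (c i))))
  have hT : ∀ y, T y = (π y, fun i => -(coeffFun (c i) y)) := fun y => rfl
  let W := Submodule.span ℝ {d | y0 + d ∈ convexHull ℝ F}
  let z0 : (ι → ℝ) × (I → ℝ) := (π y0, fun i => α i - coeffFun (c i) y0)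
  have hchar : ∀ x (s : I → ℝ), (∀ i, 0 ≤ s i) → (x, s) - z0 ∈ W.map T →
      ∃ y ∈ convexHull ℝ F, π y = x ∧ ∀ i, s i = α i - coeffFun (c i) y := by
    intro x s hs ⟨d, hd, hTd⟩
    rw [hT] at hTd
    have e1 : π d = x - π y0 := congrArg Prod.fst hTd
    have e2 : ∀ i, -(coeffFun (c i) d) = s i - (α i - coeffFun (c i) y0) := fun i =>
      congrFun (congrArg Prod.snd hTd) i
    have e3 : ∀ i, s i = α i - coeffFun (c i) (y0 + d) := by
      intro i
      rw [map_add]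
      linarith [e2 i]
    refine ⟨y0 + d, ?_, by rw [map_add, e1]; abel, e3⟩
    by_contra hnot
    obtain ⟨Φ, hΦ, h⟩ := exit_facet F hF y0 hy0 (y0 + d) hnot (by simpa using hd)
    have h1 := h (c ⟨Φ, hΦ⟩) (α ⟨Φ, hΦ⟩) (hc _) (hcΦ ⟨Φ, hΦ⟩)
    have h2 := hs ⟨Φ, hΦ⟩
    rw [e3] at h2
    linarith
  have hbd : ∃ R, ∀ y ∈ convexHull ℝ F, ∀ i, α i - coeffFun (c i) y ≤ R := by
    have hcomp := hF.isCompact_convexHull ℝ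
    have : ∀ i, ∃ R, ∀ y ∈ convexHull ℝ F, α i - coeffFun (c i) y ≤ R := by
      intro i
      have hcont : Continuous (fun y => α i - coeffFun (c i) y) := by
        simp only [coeffFun_apply]
        fun_prop
      obtain ⟨R, hR⟩ := hcomp.bddAbove_image hcont.continuousOn
      exact ⟨R, fun y hy => hR ⟨y, hy, rfl⟩⟩
    choose R hR using this
    refine ⟨∑ i, |R i|, fun y hy i => (hR i y hy).trans ((le_abs_self _).trans ?_)⟩
    exact Finset.single_le_sum (f := fun i => |R i|) (fun i _ => abs_nonneg _) (Finset.mem_univ i)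
  obtain ⟨R, hR⟩ := hbd
  refine ⟨I, inferInstance, z0, W.map T, R, ?_, ?_, ?_⟩
  · unfold xc
    rw [← hr, ← Nat.card_eq_fintype_card]
    rfl
  · intro x
    constructor
    · intro hx
      rw [← hπ] at hx
      obtain ⟨y, hy, rfl⟩ := hx
      refine ⟨fun i => α i - coeffFun (c i) y, fun i => by linarith [hc i y hy], ?_⟩
      refine ⟨y - y0, Submodule.subset_span (by simpa using hy), ?_⟩
      rw [hT]
      ext i <;> simp [z0]
    · rintro ⟨s, hs, h⟩
      obtain ⟨y, hy, hyx, _⟩ := hchar x s hs h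
      rw [← hπ]
      exact ⟨y, hy, hyx⟩
  · intro x s hs h i
    obtain ⟨y, hy, _, he⟩ := hchar x s hs h
    rw [he i]
    exact hR y hy i

theorem nonpos_of_ray {a b R : ℝ} (h : ∀ n : ℝ, 0 ≤ n → a + n * b ≤ R) : b ≤ 0 := by
  by_contra hb
  push Not at hb
  have h1 := h ((|R| + |a| + 1) / b) (by positivity)
  rw [div_mul_cancel₀ _ hb.ne'] at h1
  have := le_abs_self R
  have := neg_abs_le a
  linarith

theorem slack_rec {ι I : Type*} {P : Set (ι → ℝ)} {z0 : (ι → ℝ) × (I → ℝ)}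
    {D : Submodule ℝ ((ι → ℝ) × (I → ℝ))} {R : ℝ} (h : SlackRep P z0 D R)
    {p : ι → ℝ} (hp : p ∈ P) {B : ℝ} (hB : ∀ x ∈ P, ∀ v, |x v| ≤ B)
    {x : ι → ℝ} {s : I → ℝ} (hs : ∀ i, 0 ≤ s i) (hD : (x, s) ∈ D) :
    x = 0 ∧ s = 0 := by
  obtain ⟨sp, hsp, hpD⟩ := (h.1 p).1 hp
  have key : ∀ n : ℝ, 0 ≤ n → (p + n • x, sp + n • s) - z0 ∈ D := by
    intro n _
    have := D.add_mem hpD (D.smul_mem n hD)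
    convert this using 1
    ext <;> simp <;> ring
  have hs' : ∀ n : ℝ, 0 ≤ n → ∀ i, 0 ≤ (sp + n • s) i := by
    intro n hn i
    have := hsp i
    have := hs i
    simp only [Pi.add_apply, Pi.smul_apply, smul_eq_mul]
    positivity
  have hPn : ∀ n : ℝ, 0 ≤ n → p + n • x ∈ P := fun n hn =>
    (h.1 _).2 ⟨_, hs' n hn, key n hn⟩
  constructor
  · funext v
    apply le_antisymm
    · apply nonpos_of_ray (a := p v) (R := B)
      intro n hn
      exact (abs_le.1 (hB _ (hPn n hn) v)).2
    · have : -(x v) ≤ 0 := by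
        apply nonpos_of_ray (a := -(p v)) (R := B)
        intro n hn
        have := (abs_le.1 (hB _ (hPn n hn) v)).1
        simp only [Pi.add_apply, Pi.smul_apply, smul_eq_mul] at this
        linarith
      simpa using this
  · funext i
    apply le_antisymm _ (hs i)
    apply nonpos_of_ray (a := sp i) (R := R)
    intro n hn
    exact h.2 _ _ (hs' n hn) (key n hn) i

theorem slack_hom {ι I : Type*} {P : Set (ι → ℝ)} {z0 : (ι → ℝ) × (I → ℝ)}
    {D : Submodule ℝ ((ι → ℝ) × (I → ℝ))} {R : ℝ} (h : SlackRep P z0 D R)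
    {p q : ι → ℝ} (hp : p ∈ P) (hq : q ∈ P) (hpq : p ≠ q)
    {B : ℝ} (hB : ∀ x ∈ P, ∀ v, |x v| ≤ B)
    {x : ι → ℝ} {s : I → ℝ} {t : ℝ} (hs : ∀ i, 0 ≤ s i) (hD : (x, s) - t • z0 ∈ D) :
    0 ≤ t ∧ (∃ p ∈ P, x = t • p) ∧ ∀ i, s i ≤ t * R := by
  have ht : 0 ≤ t := by
    by_contra ht
    push Not at ht
    have key : ∀ q ∈ P, (-t) • q + x = 0 := by
      intro q hq
      obtain ⟨sq, hsq, hqD⟩ := (h.1 q).1 hq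
      refine (slack_rec h hp hB (x := (-t) • q + x) (s := (-t) • sq + s) ?_ ?_).1
      · intro i
        have := hsq i
        have := hs i
        have : 0 ≤ -t := by linarith
        simp only [Pi.add_apply, Pi.smul_apply, smul_eq_mul]
        positivity
      · have := D.add_mem (D.smul_mem (-t) hqD) hD
        convert this using 1
        ext <;> simp <;> ring
    apply hpq
    have h1 := key p hp
    have h2 := key q hq
    have h3 : (-t) • p = (-t) • q := by
      rw [← h2] at h1
      exact add_right_cancel h1
    exact smul_right_injective _ (by linarith : -t ≠ 0) h3
  refine ⟨ht, ?_⟩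
  rcases ht.eq_or_lt with rfl | ht'
  · obtain ⟨rfl, rfl⟩ := slack_rec h hp hB hs (by simpa using hD)
    exact ⟨⟨p, hp, by simp⟩, by simp⟩
  · have h1 : (t⁻¹ • x, t⁻¹ • s) - z0 ∈ D := by
      have := D.smul_mem t⁻¹ hD
      convert this using 1
      rw [smul_sub, smul_smul, inv_mul_cancel₀ ht'.ne', one_smul]
      rfl
    have h2 : ∀ i, 0 ≤ (t⁻¹ • s) i := by
      intro i
      have := hs i
      simp only [Pi.smul_apply, smul_eq_mul]
      positivity
    refine ⟨⟨t⁻¹ • x, (h.1 _).2 ⟨_, h2, h1⟩, ?_⟩, ?_⟩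
    · rw [smul_smul, mul_inv_cancel₀ ht'.ne', one_smul]
    · intro i
      have := h.2 _ _ h2 h1 i
      simp only [Pi.smul_apply, smul_eq_mul] at this
      rwa [inv_mul_le_iff₀ ht'] at this

theorem slack_hom_mem {ι I : Type*} {P : Set (ι → ℝ)} {z0 : (ι → ℝ) × (I → ℝ)}
    {D : Submodule ℝ ((ι → ℝ) × (I → ℝ))} {R : ℝ} (h : SlackRep P z0 D R)
    {p : ι → ℝ} (hp : p ∈ P) {t : ℝ} (ht : 0 ≤ t) :
    ∃ s : I → ℝ, (∀ i, 0 ≤ s i) ∧ (t • p, s) - t • z0 ∈ D := by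
  obtain ⟨s, hs, hD⟩ := (h.1 p).1 hp
  refine ⟨t • s, fun i => ?_, ?_⟩
  · have := hs i
    simp only [Pi.smul_apply, smul_eq_mul]
    positivity
  · have := D.smul_mem t hD
    rw [smul_sub] at this
    exact this

theorem stab_abs_le {V : Type*} [Fintype V] (G : SimpleGraph V) :
    ∀ x ∈ stab G, ∀ v, |x v| ≤ 1 := by
  intro x hx v
  rw [abs_of_nonneg (stab_nonneg G hx v)]
  simpa using stab_clique G hx {v} (by simp)

theorem restrict_mem_stab {V : Type*} (G : SimpleGraph V) (U : Set V) [Fintype ↥U]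
    (S T : Set V) (hS : ∀ u ∈ S, ∀ v ∈ S, ¬ G.Adj u v) :
    (fun v : U => T.indicator (S.indicator (1 : V → ℝ)) v) ∈ stab (G.induce U) := by
  classical
  apply subset_convexHull ℝ _
  refine ⟨{v | (v : V) ∈ T ∧ (v : V) ∈ S}, ?_, ?_⟩
  · rintro u ⟨_, hu⟩ v ⟨_, hv⟩ huv
    exact hS u hu v hv (by simpa using huv)
  · funext v
    by_cases h1 : (v : V) ∈ T <;> by_cases h2 : (v : V) ∈ S <;>
      simp [Set.indicator_apply, h1, h2]

theorem block_mem {V I : Type*} (G : SimpleGraph V) (U : Set V) [Fintype ↥U]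
    {z0 : (U → ℝ) × (I → ℝ)} {D : Submodule ℝ ((U → ℝ) × (I → ℝ))} {R : ℝ}
    (h : SlackRep (stab (G.induce U)) z0 D R)
    (S T : Set V) (hS : ∀ u ∈ S, ∀ v ∈ S, ¬ G.Adj u v) (t : ℝ)
    (ht : t = 1 ∨ (t = 0 ∧ ∀ v ∈ T, v ∉ S)) :
    ∃ s : I → ℝ, (∀ i, 0 ≤ s i) ∧
      ((fun v : U => T.indicator (S.indicator (1 : V → ℝ)) v), s) - t • z0 ∈ D := by
  have hmem := restrict_mem_stab G U S T hS
  rcases ht with rfl | ⟨rfl, hdis⟩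
  · simpa using slack_hom_mem h hmem (t := 1) zero_le_one
  · have e : (fun v : U => T.indicator (S.indicator (1 : V → ℝ)) v) = 0 := by
      funext v
      by_cases h1 : (v : V) ∈ T
      · simp [h1, hdis v h1]
      · simp [h1]
    obtain ⟨s, hs, hD⟩ := slack_hom_mem h hmem (t := 0) le_rfl
    refine ⟨s, hs, ?_⟩
    rw [zero_smul] at hD
    rw [e]
    exact hD

theorem clique_part {V : Type*} (G : SimpleGraph V) (U : Set V) [Fintype ↥U]
    {p : U → ℝ} (hp : p ∈ stab (G.induce U)) {t : ℝ} (ht : 0 ≤ t) (x : V → ℝ)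
    (K : Finset V) (hK : G.IsClique (K : Set V)) (hKU : ∀ v ∈ K, v ∈ U)
    (hx : ∀ v : U, (v : V) ∈ K → x v = t * p v) : ∑ v ∈ K, x v ≤ t := by
  classical
  have h1 : ∑ v ∈ K.subtype (· ∈ U), x v = ∑ v ∈ K, x v :=
    Finset.sum_subtype_of_mem x hKU
  rw [← h1, Finset.sum_congr rfl (fun v hv => hx v (by simpa using hv)), ← Finset.mul_sum]
  have h2 := stab_clique (G.induce U) hp (K.subtype (· ∈ U)) (by
    intro a ha b hb hab
    simp only [Finset.mem_coe, Finset.mem_subtype] at ha hb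
    have := hK ha hb (fun h => hab (Subtype.ext h))
    simpa using this)
  nlinarith

theorem stab_two_points {V : Type*} (G : SimpleGraph V) (U : Set V) [Fintype ↥U]
    (hU : U.Nonempty) : ∃ p ∈ stab (G.induce U), ∃ q ∈ stab (G.induce U), p ≠ q := by
  obtain ⟨u, hu⟩ := hU
  refine ⟨_, subset_convexHull ℝ _ ⟨∅, by simp, rfl⟩,
    _, subset_convexHull ℝ _ ⟨{⟨u, hu⟩}, by simp, rfl⟩, ?_⟩
  intro h
  have := congrFun h ⟨u, hu⟩
  simp at this

/-- The constraints of one side of the extension. -/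
def Side {V I : Type*} (U : Set V) (z0 : (U → ℝ) × (I → ℝ))
    (D : Submodule ℝ ((U → ℝ) × (I → ℝ))) (m : Fin 3 → Set V)
    (x : V → ℝ) (s : Fin 3 → I → ℝ) (t : Fin 3 → ℝ) : Prop :=
  ∀ j, ((fun v : U => (m j).indicator x v), s j) - t j • z0 ∈ D

theorem Side.line {V I : Type*} {U : Set V} {z0 : (U → ℝ) × (I → ℝ)}
    {D : Submodule ℝ ((U → ℝ) × (I → ℝ))} {m : Fin 3 → Set V}
    {x x' : V → ℝ} {s s' : Fin 3 → I → ℝ} {t t' : Fin 3 → ℝ}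
    (h : Side U z0 D m x s t) (h' : Side U z0 D m x' s' t') (r : ℝ) :
    Side U z0 D m (x + r • (x - x')) (s + r • (s - s')) (t + r • (t - t')) := by
  classical
  intro j
  have := D.add_mem (h j) (D.smul_mem r (D.sub_mem (h j) (h' j)))
  convert this using 1
  ext v
  · by_cases hv : (v : V) ∈ m j <;> simp [hv] <;> ring
  · simp; ring

theorem Side.isClosed {V I Z : Type*} [Fintype I] [TopologicalSpace Z] {U : Set V} [Fintype ↥U]
    {z0 : (U → ℝ) × (I → ℝ)}
    {D : Submodule ℝ ((U → ℝ) × (I → ℝ))} {m : Fin 3 → Set V}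
    {x : Z → V → ℝ} {s : Z → Fin 3 → I → ℝ} {t : Z → Fin 3 → ℝ}
    (hx : Continuous x) (hs : Continuous s) (ht : Continuous t) :
    IsClosed {z | Side U z0 D m (x z) (s z) (t z)} := by
  classical
  have : {z | Side U z0 D m (x z) (s z) (t z)} = ⋂ j, (fun z =>
      ((fun v : U => (m j).indicator (x z) v), s z j) - t z j • z0) ⁻¹' (D : Set _) := by
    ext z; simp [Side]
  rw [this]
  apply isClosed_iInter
  intro j
  apply D.closed_of_finiteDimensional.preimage
  have h1 : Continuous (fun z => (fun v : U => (m j).indicator (x z) v)) := by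
    apply continuous_pi
    intro v
    by_cases hv : (v : V) ∈ m j
    · simp only [Set.indicator_of_mem hv]; fun_prop
    · simp only [Set.indicator_of_notMem hv]; fun_prop
  exact (h1.prodMk (by fun_prop)).sub (by fun_prop)

theorem two_join_mem {V : Type*} [Fintype V] (G : SimpleGraph V) (hG : IsPerfect G)
    (V₁ V₂ : Set V) [Fintype ↥V₁] [Fintype ↥V₂] (A₁ B₁ A₂ B₂ : Set V)
    (hcov : V₁ ∪ V₂ = Set.univ) (hdisj : Disjoint V₁ V₂)
    (hA₁ : A₁ ⊆ V₁) (hB₁ : B₁ ⊆ V₁) (hA₂ : A₂ ⊆ V₂) (hB₂ : B₂ ⊆ V₂)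
    (hAB₁ : Disjoint A₁ B₁) (hAB₂ : Disjoint A₂ B₂)
    (hno : ∀ v₁ ∈ V₁, ∀ v₂ ∈ V₂, G.Adj v₁ v₂ →
      (v₁ ∈ A₁ ∧ v₂ ∈ A₂) ∨ (v₁ ∈ B₁ ∧ v₂ ∈ B₂))
    (x : V → ℝ) (t₁ t₂ : Fin 3 → ℝ) (h0₁ : t₁ 0 = 1) (h0₂ : t₂ 0 = 1)
    (h1 : t₁ 1 + t₂ 1 = 1) (h2 : t₁ 2 + t₂ 2 = 1)
    (hp₁ : ∀ j, 0 ≤ t₁ j ∧ ∃ p ∈ stab (G.induce V₁),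
      (fun v : V₁ => ((![Set.univ, A₁, B₁] : Fin 3 → Set V) j).indicator x v) = t₁ j • p)
    (hp₂ : ∀ j, 0 ≤ t₂ j ∧ ∃ p ∈ stab (G.induce V₂),
      (fun v : V₂ => ((![Set.univ, A₂, B₂] : Fin 3 → Set V) j).indicator x v) = t₂ j • p) :
    x ∈ stab G := by
  classical
  have hmem : ∀ v, v ∈ V₁ ∨ v ∈ V₂ := fun v => by
    have : v ∈ V₁ ∪ V₂ := by rw [hcov]; trivial
    exact this
  have part₁ : ∀ j, ∀ K : Finset V, G.IsClique (K : Set V) → (∀ v ∈ K, v ∈ V₁) →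
      (∀ v ∈ K, v ∈ (![Set.univ, A₁, B₁] : Fin 3 → Set V) j) → ∑ v ∈ K, x v ≤ t₁ j := by
    intro j K hK hKV hKm
    obtain ⟨ht, p, hp, he⟩ := hp₁ j
    refine clique_part G V₁ hp ht x K hK hKV (fun v hv => ?_)
    have := congrFun he v
    simpa [Set.indicator_of_mem (hKm v hv)] using this
  have part₂ : ∀ j, ∀ K : Finset V, G.IsClique (K : Set V) → (∀ v ∈ K, v ∈ V₂) →
      (∀ v ∈ K, v ∈ (![Set.univ, A₂, B₂] : Fin 3 → Set V) j) → ∑ v ∈ K, x v ≤ t₂ j := by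
    intro j K hK hKV hKm
    obtain ⟨ht, p, hp, he⟩ := hp₂ j
    refine clique_part G V₂ hp ht x K hK hKV (fun v hv => ?_)
    have := congrFun he v
    simpa [Set.indicator_of_mem (hKm v hv)] using this
  have hnn : ∀ v, 0 ≤ x v := by
    intro v
    rcases hmem v with hv | hv
    · obtain ⟨ht, p, hp, he⟩ := hp₁ 0
      have := congrFun he ⟨v, hv⟩
      simp [h0₁] at this
      rw [this]
      exact stab_nonneg _ hp _
    · obtain ⟨ht, p, hp, he⟩ := hp₂ 0
      have := congrFun he ⟨v, hv⟩
      simp [h0₂] at this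
      rw [this]
      exact stab_nonneg _ hp _
  apply mem_stab_of_clique G hG x hnn
  intro K hK
  have hsplit : ∑ v ∈ K, x v = ∑ v ∈ K.filter (· ∈ V₁), x v + ∑ v ∈ K.filter (· ∉ V₁), x v :=
    (Finset.sum_filter_add_sum_filter_not K _ _).symm
  have hnot : ∀ v, v ∉ V₁ → v ∈ V₂ := fun v hv => (hmem v).resolve_left hv
  have hnot' : ∀ v, v ∈ V₂ → v ∉ V₁ := fun v hv hv' => Set.disjoint_left.1 hdisj hv' hv
  have hc1 : G.IsClique ((K.filter (· ∈ V₁) : Finset V) : Set V) :=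
    hK.subset (by intro v hv; simp at hv; exact hv.1)
  have hc2 : G.IsClique ((K.filter (· ∉ V₁) : Finset V) : Set V) :=
    hK.subset (by intro v hv; simp at hv; exact hv.1)
  by_cases hex1 : ∃ v ∈ K, v ∈ V₁
  swap
  · push Not at hex1
    rw [← h0₂]
    exact part₂ 0 K hK (fun v hv => hnot v (hex1 v hv)) (by simp)
  by_cases hex2 : ∃ v ∈ K, v ∉ V₁
  swap
  · push Not at hex2
    rw [← h0₁]
    exact part₁ 0 K hK hex2 (by simp)
  obtain ⟨a, haK, ha⟩ := hex1
  obtain ⟨b, hbK, hb⟩ := hex2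
  have hadj : ∀ u ∈ K, ∀ v ∈ K, u ∈ V₁ → v ∉ V₁ → G.Adj u v := by
    intro u hu v hv hu1 hv1
    exact hK hu hv (by rintro rfl; exact hv1 hu1)
  have hcross : ∀ u ∈ K, ∀ v ∈ K, u ∈ V₁ → v ∉ V₁ →
      (u ∈ A₁ ∧ v ∈ A₂) ∨ (u ∈ B₁ ∧ v ∈ B₂) := fun u hu v hv hu1 hv1 =>
    hno u hu1 v (hnot v hv1) (hadj u hu v hv hu1 hv1)
  rw [Set.disjoint_left] at hAB₁ hAB₂
  rcases hcross a haK b hbK ha hb with ⟨ha', hb'⟩ | ⟨ha', hb'⟩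
  · rw [hsplit, ← h1]
    apply add_le_add
    · apply part₁ 1 _ hc1 (by simp)
      intro v hv
      simp only [Finset.mem_filter] at hv
      rcases hcross v hv.1 b hbK hv.2 hb with h | h
      · exact h.1
      · exact absurd h.2 (hAB₂ hb')
    · apply part₂ 1 _ hc2 (by simp; tauto)
      intro v hv
      simp only [Finset.mem_filter] at hv
      rcases hcross a haK v hv.1 ha hv.2 with h | h
      · exact h.2
      · exact absurd h.1 (hAB₁ ha')
  · rw [hsplit, ← h2]
    apply add_le_add
    · apply part₁ 2 _ hc1 (by simp)
      intro v hv
      simp only [Finset.mem_filter] at hv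
      rcases hcross v hv.1 b hbK hv.2 hb with h | h
      · exact absurd hb' (hAB₂ h.2)
      · exact h.1
    · apply part₂ 2 _ hc2 (by simp; tauto)
      intro v hv
      simp only [Finset.mem_filter] at hv
      rcases hcross a haK v hv.1 ha hv.2 with h | h
      · exact absurd ha' (hAB₁ h.1)
      · exact h.2

/-- for a perfect graph `G` admitting a 2-join with partition `(V₁, V₂)`,
`xc (STAB G) ≤ 3 ⬝ xc (STAB G[V₁]) + 3 ⬝ xc (STAB G[V₂])`. -/
theorem xc_stab_two_join {V : Type*} [Fintype V] (G : SimpleGraph V) (hG : IsPerfect G)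
    (V₁ V₂ : Set V) [Fintype ↥V₁] [Fintype ↥V₂] (hjoin : Is2Join G V₁ V₂) :
    xc (stab G) ≤ 3 * xc (stab (G.induce V₁)) + 3 * xc (stab (G.induce V₂)) := by
  classical
  obtain ⟨hcov, hdisj, A₁, B₁, A₂, B₂, hA₁, hB₁, hA₂, hB₂, hA₁n, hB₁n, hA₂n, hB₂n, hAB₁, hAB₂,
    hA, hB, hno⟩ := hjoin
  obtain ⟨p₁, hp₁, q₁, hq₁, hpq₁⟩ := stab_two_points G V₁ (hA₁n.mono hA₁)
  obtain ⟨p₂, hp₂, q₂, hq₂, hpq₂⟩ := stab_two_points G V₂ (hA₂n.mono hA₂)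
  obtain ⟨I₁, _, z₁, D₁, R₁, hcard₁, hrep₁⟩ := exists_slackRep (stab (G.induce V₁))
    ⟨_, stab_finite _, rfl⟩ ⟨p₁, hp₁⟩
  obtain ⟨I₂, _, z₂, D₂, R₂, hcard₂, hrep₂⟩ := exists_slackRep (stab (G.induce V₂))
    ⟨_, stab_finite _, rfl⟩ ⟨p₂, hp₂⟩
  let m₁ : Fin 3 → Set V := ![Set.univ, A₁, B₁]
  let m₂ : Fin 3 → Set V := ![Set.univ, A₂, B₂]
  let F := (V → ℝ) × (Fin 3 → I₁ → ℝ) × (Fin 3 → I₂ → ℝ) × (Fin 3 → ℝ) × (Fin 3 → ℝ)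
  let L : Set F := {z | (Side V₁ z₁ D₁ m₁ z.1 z.2.1 z.2.2.2.1 ∧
    Side V₂ z₂ D₂ m₂ z.1 z.2.2.1 z.2.2.2.2) ∧
    (z.2.2.2.1 0 = 1 ∧ z.2.2.2.2 0 = 1 ∧ z.2.2.2.1 1 + z.2.2.2.2 1 = 1 ∧
      z.2.2.2.1 2 + z.2.2.2.2 2 = 1)}
  have hL : ∀ p ∈ L, ∀ q ∈ L, ∀ t : ℝ, p + t • (p - q) ∈ L := by
    rintro p ⟨⟨hp1, hp2⟩, hp3, hp4, hp5, hp6⟩ q ⟨⟨hq1, hq2⟩, hq3, hq4, hq5, hq6⟩ t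
    refine ⟨⟨hp1.line hq1 t, hp2.line hq2 t⟩, ?_, ?_, ?_, ?_⟩
    · show p.2.2.2.1 0 + t * (p.2.2.2.1 0 - q.2.2.2.1 0) = 1
      linear_combination (1 + t) * hp3 - t * hq3
    · show p.2.2.2.2 0 + t * (p.2.2.2.2 0 - q.2.2.2.2 0) = 1
      linear_combination (1 + t) * hp4 - t * hq4
    · show (p.2.2.2.1 1 + t * (p.2.2.2.1 1 - q.2.2.2.1 1)) +
        (p.2.2.2.2 1 + t * (p.2.2.2.2 1 - q.2.2.2.2 1)) = 1
      linear_combination (1 + t) * hp5 - t * hq5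
    · show (p.2.2.2.1 2 + t * (p.2.2.2.1 2 - q.2.2.2.1 2)) +
        (p.2.2.2.2 2 + t * (p.2.2.2.2 2 - q.2.2.2.2 2)) = 1
      linear_combination (1 + t) * hp6 - t * hq6
  let l : (Fin 3 × I₁) ⊕ (Fin 3 × I₂) → F →ₗ[ℝ] ℝ := Sum.elim
    (fun i => { toFun := fun z => z.2.1 i.1 i.2, map_add' := fun _ _ => rfl,
                map_smul' := fun _ _ => rfl })
    (fun i => { toFun := fun z => z.2.2.1 i.1 i.2, map_add' := fun _ _ => rfl,
                map_smul' := fun _ _ => rfl })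
  let Q : Set F := {z | z ∈ L ∧ ∀ i, 0 ≤ l i z}
  have hl₁ : ∀ z ∈ Q, ∀ j i, 0 ≤ z.2.1 j i := fun z hz j i => hz.2 (Sum.inl (j, i))
  have hl₂ : ∀ z ∈ Q, ∀ j i, 0 ≤ z.2.2.1 j i := fun z hz j i => hz.2 (Sum.inr (j, i))
  have hom₁ : ∀ z ∈ Q, ∀ j, _ := fun z hz j =>
    slack_hom hrep₁ hp₁ hq₁ hpq₁ (stab_abs_le _) (hl₁ z hz j) (hz.1.1.1 j)
  have hom₂ : ∀ z ∈ Q, ∀ j, _ := fun z hz j =>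
    slack_hom hrep₂ hp₂ hq₂ hpq₂ (stab_abs_le _) (hl₂ z hz j) (hz.1.1.2 j)
  have hQstab : ∀ z ∈ Q, z.1 ∈ stab G := by
    intro z hz
    obtain ⟨_, h3, h4, h5, h6⟩ := hz.1
    exact two_join_mem G hG V₁ V₂ A₁ B₁ A₂ B₂ hcov hdisj hA₁ hB₁ hA₂ hB₂ hAB₁ hAB₂ hno z.1
      z.2.2.2.1 z.2.2.2.2 h3 h4 h5 h6 (fun j => ⟨(hom₁ z hz j).1, (hom₁ z hz j).2.1⟩)
      (fun j => ⟨(hom₂ z hz j).1, (hom₂ z hz j).2.1⟩)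
  have ht1 : ∀ z ∈ Q, ∀ j, z.2.2.2.1 j ≤ 1 ∧ z.2.2.2.2 j ≤ 1 := by
    intro z hz j
    obtain ⟨_, h3, h4, h5, h6⟩ := hz.1
    have a1 := fun j => (hom₁ z hz j).1
    have a2 := fun j => (hom₂ z hz j).1
    have b1 := a1 1
    have b2 := a1 2
    have b3 := a2 1
    have b4 := a2 2
    fin_cases j
    · exact ⟨h3.le, h4.le⟩
    · exact ⟨by show z.2.2.2.1 1 ≤ 1; linarith, by show z.2.2.2.2 1 ≤ 1; linarith⟩
    · exact ⟨by show z.2.2.2.1 2 ≤ 1; linarith, by show z.2.2.2.2 2 ≤ 1; linarith⟩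
  have hclosed : IsClosed Q := by
    have c1 : IsClosed L := by
      apply IsClosed.inter
      · apply IsClosed.inter
        · exact Side.isClosed (Z := F) (by fun_prop) (by fun_prop) (by fun_prop)
        · exact Side.isClosed (Z := F) (by fun_prop) (by fun_prop) (by fun_prop)
      · apply IsClosed.inter
        · exact isClosed_eq (by fun_prop) (by fun_prop)
        apply IsClosed.inter
        · exact isClosed_eq (by fun_prop) (by fun_prop)
        apply IsClosed.inter
        · exact isClosed_eq (by fun_prop) (by fun_prop)
        · exact isClosed_eq (by fun_prop) (by fun_prop)
    have c2 : IsClosed {z : F | ∀ i, 0 ≤ l i z} := by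
      have : {z : F | ∀ i, 0 ≤ l i z} = ⋂ i, {z | 0 ≤ l i z} := by ext; simp
      rw [this]
      exact isClosed_iInter fun i =>
        isClosed_le continuous_const (LinearMap.continuous_of_finiteDimensional (l i))
    exact c1.inter c2
  have hcomp : IsCompact Q := by
    refine IsCompact.of_isClosed_subset (isCompact_Icc (a := (0 : F))
      (b := (fun _ => 1, fun _ _ => |R₁|, fun _ _ => |R₂|, fun _ => 1, fun _ => 1))) hclosed ?_
    intro z hz
    refine ⟨⟨?_, ?_, ?_, ?_, ?_⟩, ⟨?_, ?_, ?_, ?_, ?_⟩⟩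
    · exact fun v => stab_nonneg G (hQstab z hz) v
    · exact fun j i => hl₁ z hz j i
    · exact fun j i => hl₂ z hz j i
    · exact fun j => (hom₁ z hz j).1
    · exact fun j => (hom₂ z hz j).1
    · exact fun v => (abs_le.1 (stab_abs_le G _ (hQstab z hz) v)).2
    · intro j i
      refine ((hom₁ z hz j).2.2 i).trans ?_
      calc _ ≤ z.2.2.2.1 j * |R₁| := mul_le_mul_of_nonneg_left (le_abs_self _) (hom₁ z hz j).1
        _ ≤ 1 * |R₁| := mul_le_mul_of_nonneg_right (ht1 z hz j).1 (abs_nonneg _)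
        _ = |R₁| := one_mul _
    · intro j i
      refine ((hom₂ z hz j).2.2 i).trans ?_
      calc _ ≤ z.2.2.2.2 j * |R₂| := mul_le_mul_of_nonneg_left (le_abs_self _) (hom₂ z hz j).1
        _ ≤ 1 * |R₂| := mul_le_mul_of_nonneg_right (ht1 z hz j).2 (abs_nonneg _)
        _ = |R₂| := one_mul _
    · exact fun j => (ht1 z hz j).1
    · exact fun j => (ht1 z hz j).2
  have hconv : Convex ℝ Q := (isPolytope_of_compact L hL l Q (fun y => Iff.rfl) hcomp).1
  have himg : (LinearMap.fst ℝ (V → ℝ) _ : F →ₗ[ℝ] (V → ℝ)) '' Q = stab G := by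
    apply Set.Subset.antisymm
    · rintro _ ⟨z, hz, rfl⟩
      exact hQstab z hz
    · apply convexHull_min _ (hconv.linear_image _)
      rintro x ⟨S, hS, rfl⟩
      let a : ℝ := if ∃ v ∈ A₁, v ∈ S then 1 else 0
      let b : ℝ := if ∃ v ∈ B₁, v ∈ S then 1 else 0
      have ha₁ : a = 1 ∨ (a = 0 ∧ ∀ v ∈ A₁, v ∉ S) := by
        by_cases h : ∃ v ∈ A₁, v ∈ S
        · left; simp only [a, if_pos h]
        · right; simp only [a, if_neg h]; push Not at h; exact ⟨trivial, h⟩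
      have hb₁ : b = 1 ∨ (b = 0 ∧ ∀ v ∈ B₁, v ∉ S) := by
        by_cases h : ∃ v ∈ B₁, v ∈ S
        · left; simp only [b, if_pos h]
        · right; simp only [b, if_neg h]; push Not at h; exact ⟨trivial, h⟩
      have ha₂ : 1 - a = 1 ∨ (1 - a = 0 ∧ ∀ v ∈ A₂, v ∉ S) := by
        by_cases h : ∃ v ∈ A₁, v ∈ S
        · right
          simp only [a, if_pos h, sub_self, true_and]
          obtain ⟨u, hu, huS⟩ := h
          exact fun v hv hvS => hS u huS v hvS (hA u hu v hv)
        · left; simp only [a, if_neg h, sub_zero]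
      have hb₂ : 1 - b = 1 ∨ (1 - b = 0 ∧ ∀ v ∈ B₂, v ∉ S) := by
        by_cases h : ∃ v ∈ B₁, v ∈ S
        · right
          simp only [b, if_pos h, sub_self, true_and]
          obtain ⟨u, hu, huS⟩ := h
          exact fun v hv hvS => hS u huS v hvS (hB u hu v hv)
        · left; simp only [b, if_neg h, sub_zero]
      have e₁ : ∀ j, (![1, a, b] : Fin 3 → ℝ) j = 1 ∨
          ((![1, a, b] : Fin 3 → ℝ) j = 0 ∧ ∀ v ∈ m₁ j, v ∉ S) := by
        intro j
        fin_cases j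
        · left; rfl
        · exact ha₁
        · exact hb₁
      have e₂ : ∀ j, (![1, 1 - a, 1 - b] : Fin 3 → ℝ) j = 1 ∨
          ((![1, 1 - a, 1 - b] : Fin 3 → ℝ) j = 0 ∧ ∀ v ∈ m₂ j, v ∉ S) := by
        intro j
        fin_cases j
        · left; rfl
        · exact ha₂
        · exact hb₂
      choose s₁ hs₁ hsD₁ using fun j => block_mem G V₁ hrep₁ S (m₁ j) hS _ (e₁ j)
      choose s₂ hs₂ hsD₂ using fun j => block_mem G V₂ hrep₂ S (m₂ j) hS _ (e₂ j)
      refine ⟨(S.indicator 1, s₁, s₂, ![1, a, b], ![1, 1 - a, 1 - b]),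
        ⟨⟨⟨hsD₁, hsD₂⟩, rfl, rfl, ?_, ?_⟩, ?_⟩, rfl⟩
      · simp
      · simp
      · rintro (⟨j, i⟩ | ⟨j, i⟩)
        · exact hs₁ j i
        · exact hs₂ j i
  have := xc_le_of_rep L hL l Q (fun y => Iff.rfl) hcomp (stab G) _ himg
  simpa [hcard₁, hcard₂] using this
end
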